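/- arXiv:2201.11334 — 2 statements merged into one kernel-verified Lean document; each statement's English description precedes it below -/
import Mathlib

section
/- Fix integers r >= 1 and k >= 0. Then the set of pairs (q, n), where q is a prime power and n > 2ϑ is a positive integer such that r divides q^n - 1 and x^n - 1 has a monic degree-k divisor in F_q[x], for which there exists NO pair (α, α^{-1}) of r-primitive k-normal elements in F_{q^n} over F_q, is finite. Here ϑ = 2k if gcd(q, n) = 1 and ϑ = 3k otherwise. -/
open Polynomial

noncomputable section

/-- The action `h ∘ β = Σ_i a_i β^{q^i}` of a polynomial `h = Σ_i a_i x^i` over `F_q`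
on an element `β` of an extension field. -/
def polyAct {Fq F : Type*} [Field Fq] [Field F] [Algebra Fq F]
    (q : ℕ) (h : Fq[X]) (β : F) : F :=
  h.sum fun i a => algebraMap Fq F a * β ^ q ^ i

/-- `h` is the `F_q`-order of `β`: the monic divisor of `x^n - 1` of least degree
annihilating `β`. -/
def IsFqOrder {Fq F : Type*} [Field Fq] [Field F] [Algebra Fq F]
    (q n : ℕ) (h : Fq[X]) (β : F) : Prop :=
  h.Monic ∧ h ∣ (X ^ n - 1 : Fq[X]) ∧ polyAct q h β = 0 ∧
    ∀ h' : Fq[X], h'.Monic → h' ∣ (X ^ n - 1 : Fq[X]) → polyAct q h' β = 0 →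
      h.natDegree ≤ h'.natDegree

/-- `α` is `k`-normal over `F_q`: its `F_q`-order has degree `n - k`. -/
def IsKNormal (Fq : Type*) {F : Type*} [Field Fq] [Field F] [Algebra Fq F]
    (q n k : ℕ) (α : F) : Prop :=
  ∃ h : Fq[X], IsFqOrder q n h α ∧ h.natDegree = n - k

namespace Valuation

variable {A Γ₀ : Type*} [CommRing A] [LinearOrderedCommGroupWithZero Γ₀]

/-- A finite sum whose nonzero terms have pairwise distinct valuations `τ ^ e i`
has the valuation of one of its nonzero terms. -/
theorem exists_map_sum_eq_pow {ι : Type*} (v : Valuation A Γ₀) {τ : Γ₀} (hτ : 1 < τ)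
    (s : Finset ι) (f : ι → A) (e : ι → ℕ)
    (hv : ∀ i ∈ s, f i ≠ 0 → v (f i) = τ ^ e i)
    (he : ∀ i ∈ s, ∀ j ∈ s, f i ≠ 0 → f j ≠ 0 → e i = e j → i = j)
    (hne : ∃ i ∈ s, f i ≠ 0) :
    ∃ j ∈ s, f j ≠ 0 ∧ v (∑ i ∈ s, f i) = τ ^ e j ∧ ∀ i ∈ s, f i ≠ 0 → e i ≤ e j := by
  classical
  obtain ⟨j, hj, hmax⟩ := (s.filter fun i => f i ≠ 0).exists_max_image e
    (by obtain ⟨i, hi, hfi⟩ := hne; exact ⟨i, by simp [hi, hfi]⟩)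
  simp only [Finset.mem_filter] at hj hmax
  have hpos : ∀ m : ℕ, τ ^ m ≠ 0 := fun m => pow_ne_zero _ (zero_lt_one.trans hτ).ne'
  refine ⟨j, hj.1, hj.2, ?_, fun i hi h => hmax i ⟨hi, h⟩⟩
  rw [← hv j hj.1 hj.2]
  refine v.map_sum_eq_of_lt hj.1 fun i hi => ?_
  simp only [Finset.mem_sdiff, Finset.mem_singleton] at hi
  rw [hv j hj.1 hj.2]
  by_cases h0 : f i = 0
  · rw [h0, map_zero]; exact zero_lt_iff.2 (hpos _)
  · rw [hv i hi.1 h0]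
    refine pow_lt_pow_right₀ hτ (lt_of_le_of_ne (hmax i ⟨hi.1, h0⟩) fun h => hi.2 ?_)
    exact he i hi.1 j hj.1 h0 hj.2 h

end Valuation

/-- A `K`-algebra over a finite field with a valuation and a `K`-basis whose members have
pairwise distinct valuations `τ ^ wt i`, such that every exponent from `c` on occurs. It models
the ring of functions of a curve that are regular away from a single place. -/
structure OnePlaceRing (K A ι Γ₀ : Type*) [Field K] [CommRing A] [Algebra K A]
    [LinearOrderedCommGroupWithZero Γ₀] where
  /-- the valuation at the place -/
  v : Valuation A Γ₀
  /-- the value of a pole of order one -/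
  τ : Γ₀
  /-- a basis adapted to the pole order -/
  b : Module.Basis ι K A
  /-- the pole orders of the basis elements -/
  wt : ι → ℕ
  /-- the bound from which on every pole order occurs -/
  c : ℕ
  one_lt_τ : 1 < τ
  v_algebraMap : ∀ x : K, x ≠ 0 → v (algebraMap K A x) = 1
  v_b : ∀ i, v (b i) = τ ^ wt i
  wt_injective : Function.Injective wt
  exists_wt_eq : ∀ m, c ≤ m → ∃ i, wt i = m

namespace OnePlaceRing

variable {K A ι Γ₀ : Type*} [Field K] [CommRing A] [Algebra K A]
    [LinearOrderedCommGroupWithZero Γ₀] (O : OnePlaceRing K A ι Γ₀)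

theorem τ_pow_le_iff {m n : ℕ} : O.τ ^ m ≤ O.τ ^ n ↔ m ≤ n :=
  pow_le_pow_iff_right₀ O.one_lt_τ

theorem τ_pow_ne_zero (m : ℕ) : O.τ ^ m ≠ 0 :=
  pow_ne_zero _ (zero_lt_one.trans O.one_lt_τ).ne'

/-- The indices of the basis elements of pole order at most `m`. -/
def idx (m : ℕ) : Set ι := {i | O.wt i ≤ m}

theorem finite_idx (m : ℕ) : (O.idx m).Finite :=
  (Set.finite_Iic m).preimage O.wt_injective.injOn

instance (m : ℕ) : Finite (O.idx m) := O.finite_idx m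

theorem card_idx_le (m : ℕ) : Nat.card (O.idx m) ≤ m + 1 := by
  have := Nat.card_le_card_of_injective (fun i : O.idx m => (⟨O.wt i, Nat.lt_succ_of_le i.2⟩ :
    Fin (m + 1))) (fun i j h => Subtype.ext (O.wt_injective (by simpa using h)))
  simpa using this

theorem le_card_idx (m : ℕ) : m + 1 ≤ Nat.card (O.idx m) + O.c := by
  have : Nonempty ι := ⟨(O.exists_wt_eq O.c le_rfl).choose⟩
  choose! f hf using O.exists_wt_eq
  have := Nat.card_le_card_of_injective
    (fun i : Fin (m + 1 - O.c) => (⟨f (O.c + i), by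
      have := hf (O.c + i) (by lia)
      simp only [idx, Set.mem_ofPred_eq, this]; lia⟩ : O.idx m)) (fun i j h => by
      have h1 : f (O.c + i) = f (O.c + j) := congrArg Subtype.val h
      have h2 := congrArg O.wt h1
      rw [hf _ (by lia), hf _ (by lia)] at h2
      exact Fin.ext (by lia))
  simp only [Nat.card_eq_fintype_card, Fintype.card_fin] at this
  lia

/-- The functions of pole order at most `m`. -/
def fil (m : ℕ) : Submodule K A where
  carrier := {f | O.v f ≤ O.τ ^ m}
  add_mem' ha hb := O.v.map_add_le ha hb
  zero_mem' := by simp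
  smul_mem' x f hf := by
    by_cases hx : x = 0
    · simp [hx]
    · simpa [Algebra.smul_def, O.v_algebraMap x hx] using hf

theorem mem_fil {m : ℕ} {f : A} : f ∈ O.fil m ↔ O.v f ≤ O.τ ^ m := Iff.rfl

theorem fil_mono {m n : ℕ} (h : m ≤ n) : O.fil m ≤ O.fil n :=
  fun _ hf => le_trans hf (O.τ_pow_le_iff.2 h)

theorem v_eq_pow {f : A} (hf : f ≠ 0) :
    ∃ j, O.b.repr f j ≠ 0 ∧ O.v f = O.τ ^ O.wt j ∧ ∀ i, O.b.repr f i ≠ 0 → O.wt i ≤ O.wt j := by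
  have hb : ∀ i, O.b i ≠ 0 := fun i h => O.τ_pow_ne_zero (O.wt i) (by rw [← O.v_b, h, map_zero])
  have hsum : f = ∑ i ∈ (O.b.repr f).support, O.b.repr f i • O.b i :=
    (O.b.linearCombination_repr f).symm
  have hv : ∀ i, O.b.repr f i ≠ 0 → O.v (O.b.repr f i • O.b i) = O.τ ^ O.wt i := fun i hi => by
    rw [Algebra.smul_def, map_mul, O.v_algebraMap _ hi, one_mul, O.v_b]
  have hne : ∀ i, O.b.repr f i ≠ 0 → O.b.repr f i • O.b i ≠ 0 := fun i hi h => by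
    have := hv i hi
    rw [h, map_zero] at this
    exact O.τ_pow_ne_zero _ this.symm
  have h0 : O.b.repr f ≠ 0 := by simpa using hf
  obtain ⟨j, hj, -, hvj, hmax⟩ := O.v.exists_map_sum_eq_pow O.one_lt_τ (O.b.repr f).support
    (fun i => O.b.repr f i • O.b i) O.wt (fun i hi _ => hv i (by simpa using hi))
    (fun i _ j _ _ _ h => O.wt_injective h)
    (by
      obtain ⟨i, hi⟩ := Finsupp.support_nonempty_iff.2 h0
      exact ⟨i, hi, hne i (by simpa using hi)⟩)
  refine ⟨j, by simpa using hj, by rw [← hvj, ← hsum], fun i hi => hmax i (by simpa using hi) ?_⟩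
  exact hne i hi

theorem exists_v_eq_pow {f : A} (hf : f ≠ 0) : ∃ m : ℕ, O.v f = O.τ ^ m := by
  obtain ⟨j, -, h, -⟩ := O.v_eq_pow hf
  exact ⟨_, h⟩

theorem v_eq_zero_iff {f : A} : O.v f = 0 ↔ f = 0 := by
  refine ⟨fun h => ?_, fun h => by rw [h, map_zero]⟩
  by_contra hf
  obtain ⟨m, hm⟩ := O.exists_v_eq_pow hf
  exact O.τ_pow_ne_zero m (hm ▸ h)

theorem mem_fil_iff_support {m : ℕ} {f : A} :
    f ∈ O.fil m ↔ ∀ i, O.b.repr f i ≠ 0 → i ∈ O.idx m := by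
  by_cases hf : f = 0
  · simp [hf]
  obtain ⟨j, hj, hv, hmax⟩ := O.v_eq_pow hf
  rw [mem_fil, hv, O.τ_pow_le_iff]
  exact ⟨fun h i hi => (hmax i hi).trans h, fun h => h j hj⟩

theorem fil_eq_span (m : ℕ) : O.fil m = Submodule.span K (O.b '' O.idx m) := by
  ext f
  rw [O.mem_fil_iff_support, Module.Basis.mem_span_image]
  simp [Set.subset_def]

theorem card_fil [Finite K] (m : ℕ) : Nat.card (O.fil m) = Nat.card K ^ Nat.card (O.idx m) := by
  have hli : LinearIndependent K fun i : O.idx m => O.b i :=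
    O.b.linearIndependent.comp _ Subtype.val_injective
  have hr : Set.range (fun i : O.idx m => O.b i) = O.b '' O.idx m := by
    ext; simp
  have e := (Module.Basis.span hli).equivFun
  rw [O.fil_eq_span, ← hr, Nat.card_congr e.toEquiv, Nat.card_fun]

instance [Finite K] (m : ℕ) : Finite (O.fil m) := by
  refine Nat.finite_of_card_ne_zero ?_
  rw [O.card_fil]
  exact pow_ne_zero _ Nat.card_pos.ne'

theorem exists_mem_fil (f : A) : ∃ m, f ∈ O.fil m := by
  by_cases hf : f = 0
  · exact ⟨0, hf ▸ zero_mem _⟩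
  · obtain ⟨m, hm⟩ := O.exists_v_eq_pow hf
    exact ⟨m, hm.le⟩

theorem mul_mem_fil {m n : ℕ} {f g : A} (hf : f ∈ O.fil m) (hg : g ∈ O.fil n) :
    f * g ∈ O.fil (m + n) := by
  rw [mem_fil, map_mul, pow_add]
  exact mul_le_mul' hf hg

theorem pow_mem_fil {m : ℕ} {f : A} (hf : f ∈ O.fil m) (n : ℕ) : f ^ n ∈ O.fil (m * n) := by
  rw [mem_fil, map_pow, pow_mul]
  exact pow_le_pow_left' hf n

open Classical in
/-- Finitely many distinct points have interpolating functions. -/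
theorem _root_.AlgHom.exists_interpolation {K A : Type*} [Field K] [CommRing A] [Algebra K A]
    (T : Finset (A →ₐ[K] K)) :
    ∃ δ : (A →ₐ[K] K) → A, ∀ P ∈ T, ∀ P' ∈ T, P' (δ P) = if P' = P then 1 else 0 := by
  have hsep : ∀ P P' : A →ₐ[K] K, ∃ f : A, P' ≠ P → P f = 1 ∧ P' f = 0 := by
    intro P P'
    by_cases h : P' = P
    · exact ⟨0, fun h' => (h' h).elim⟩
    · obtain ⟨f, hf⟩ : ∃ f, P' f ≠ P f := by
        by_contra! hc
        exact h (AlgHom.ext hc)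
      have hne : P f - P' f ≠ 0 := sub_ne_zero.2 (Ne.symm hf)
      refine ⟨algebraMap K A (P f - P' f)⁻¹ * (f - algebraMap K A (P' f)), fun _ => ⟨?_, ?_⟩⟩
      · simp only [map_mul, AlgHom.commutes, map_sub, Algebra.algebraMap_self_apply]
        exact inv_mul_cancel₀ hne
      · simp
  choose g hg using hsep
  refine ⟨fun P => ∏ P' ∈ T.erase P, g P P', fun P _ P' hP' => ?_⟩
  rw [map_prod]
  split_ifs with h
  · subst h
    exact Finset.prod_eq_one fun P'' hP'' => (hg _ _ (Finset.ne_of_mem_erase hP'')).1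
  · exact Finset.prod_eq_zero (Finset.mem_erase.2 ⟨h, hP'⟩) (hg P P' h).2

/-- A nonzero function of pole order at most `M` has at most `M + c` zeros. -/
theorem card_zeros_le [Finite K] {M : ℕ} {R : A} (hR : R ≠ 0) (hRM : R ∈ O.fil M)
    (T : Finset (A →ₐ[K] K)) (hT : ∀ P ∈ T, P R = 0) : T.card ≤ M + O.c := by
  classical
  obtain ⟨δ, hδ⟩ := AlgHom.exists_interpolation T
  choose d hd using fun P => O.exists_mem_fil (δ P)
  set k := T.sup d
  have hmem : ∀ (f : O.fil k) (l : T → K),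
      R * (f : A) + ∑ P : T, algebraMap K A (l P) * δ P ∈ O.fil (M + k) := by
    intro f l
    refine add_mem (O.mul_mem_fil hRM f.2) (sum_mem fun P _ => ?_)
    rw [← Algebra.smul_def]
    exact Submodule.smul_mem _ _ (O.fil_mono ((Finset.le_sup P.2).trans (Nat.le_add_left _ _))
      (hd P))
  let Φ : O.fil k × (T → K) → O.fil (M + k) := fun x => ⟨_, hmem x.1 x.2⟩
  have heval : ∀ (f : O.fil k) (l : T → K) (P : T),
      (P : A →ₐ[K] K) (R * (f : A) + ∑ P : T, algebraMap K A (l P) * δ P) = l P := by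
    intro f l P
    rw [map_add, map_mul, hT P P.2, zero_mul, zero_add, map_sum, Finset.sum_eq_single P]
    · simp [hδ P P.2 P P.2]
    · intro P' _ hne
      have : (P : A →ₐ[K] K) ≠ P' := fun h => hne (Subtype.ext h.symm)
      simp [hδ P' P'.2 P P.2, this]
    · simp
  have hinj : Function.Injective Φ := by
    rintro ⟨f, l⟩ ⟨f', l'⟩ h
    have h1 : R * (f : A) + ∑ P : T, algebraMap K A (l P) * δ P =
      R * (f' : A) + ∑ P : T, algebraMap K A (l' P) * δ P := congrArg Subtype.val h
    have hl : l = l' := by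
      ext P
      rw [← heval f l P, h1, heval]
    subst hl
    have h2 : R * ((f : A) - f') = 0 := by rw [mul_sub]; exact sub_eq_zero.2 (add_right_cancel h1)
    have h3 : (f : A) - f' = 0 := by
      have := congrArg O.v h2
      rw [map_mul, map_zero, mul_eq_zero, O.v_eq_zero_iff, O.v_eq_zero_iff] at this
      exact this.resolve_left hR
    exact Prod.ext (Subtype.ext (sub_eq_zero.1 h3)) rfl
  have hc := Nat.card_le_card_of_injective Φ hinj
  rw [Nat.card_prod, O.card_fil, O.card_fil, Nat.card_fun, ← pow_add,
    Nat.pow_le_pow_iff_right Finite.one_lt_card, Nat.card_eq_fintype_card (α := T),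
    Fintype.card_coe] at hc
  have := O.card_idx_le (M + k)
  have := O.le_card_idx k
  lia

/-- **Bombieri's bound**: over a field with `S ^ 2` elements, the number of rational points is at
most `S ^ 2 + O(S)`. -/
theorem card_points_le [Finite K] (p e S : ℕ) [Fact p.Prime] [CharP K p]
    (hS : S = p ^ e) (hK : Nat.card K = S ^ 2) (hlarge : O.c ^ 2 + 3 * O.c + 1 < S)
    (T : Finset (A →ₐ[K] K)) : T.card ≤ S ^ 2 + (2 * O.c + 1) * S + O.c := by
  classical
  have hnt : Nontrivial A := by
    obtain ⟨i, -⟩ := O.exists_wt_eq O.c le_rfl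
    exact ⟨O.b i, 0, O.b.ne_zero i⟩
  have : CharP A p := charP_of_injective_algebraMap (algebraMap K A).injective p
  have : ExpChar A p := ExpChar.prime (Fact.out)
  have : ExpChar K p := ExpChar.prime (Fact.out)
  have : Fintype (O.idx (S + 2 * O.c)) := Fintype.ofFinite _
  set m := S + 2 * O.c with hm
  set l := S - 1 with hl
  have hmem : ∀ s : O.idx m → O.fil l, ∑ i, (s i : A) ^ S * O.b i ∈ O.fil (l * S + m) := by
    intro s
    refine sum_mem fun i _ => O.mul_mem_fil (O.pow_mem_fil (s i).2 S) ?_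
    rw [mem_fil, O.v_b, O.τ_pow_le_iff]
    exact i.2
  let Θ : (O.idx m → O.fil l) → O.fil (l * S + m) := fun s => ⟨_, hmem s⟩
  have hnotinj : ¬ Function.Injective Θ := by
    intro hinj
    have hc := Nat.card_le_card_of_injective Θ hinj
    rw [Nat.card_fun, O.card_fil, O.card_fil, ← pow_mul,
      Nat.pow_le_pow_iff_right Finite.one_lt_card] at hc
    have h1 := O.card_idx_le (l * S + m)
    have h2 := O.le_card_idx l
    have h3 := O.le_card_idx m
    have h4 : (S - O.c) * (S + O.c + 1) ≤ Nat.card (O.idx l) * Nat.card (O.idx m) :=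
      Nat.mul_le_mul (by lia) (by lia)
    have h5 : (S - O.c) * (S + O.c + 1) ≤ l * S + m + 1 := h4.trans (hc.trans h1)
    obtain ⟨x, rfl⟩ : ∃ x, S = O.c + x + 1 := ⟨S - O.c - 1, by lia⟩
    simp only [hl, hm] at h5
    have e1 : O.c + x + 1 - O.c = x + 1 := by lia
    have e2 : O.c + x + 1 - 1 = O.c + x := by lia
    rw [e1, e2] at h5
    nlinarith
  obtain ⟨s, s', hss', hne⟩ := Function.not_injective_iff.1 hnotinj
  set t : O.idx m → A := fun i => (s i : A) - s' i with ht
  have htmem : ∀ i, t i ∈ O.fil l := fun i => sub_mem (s i).2 (s' i).2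
  have htsum : ∑ i, t i ^ S * O.b i = 0 := by
    have h1 : ∑ i, (s i : A) ^ S * O.b i = ∑ i, (s' i : A) ^ S * O.b i :=
      congrArg Subtype.val hss'
    rw [← sub_eq_zero.2 h1, ← Finset.sum_sub_distrib]
    refine Finset.sum_congr rfl fun i _ => ?_
    rw [ht, hS, sub_pow_expChar_pow, sub_mul]
  obtain ⟨i₀, hi₀⟩ : ∃ i, t i ≠ 0 := by
    by_contra! hc
    exact hne (funext fun i => Subtype.ext (sub_eq_zero.1 (hc i)))
  have hS0 : 0 < S := by lia
  choose! k hk using fun (f : A) (hf : f ≠ 0) => O.exists_v_eq_pow hf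
  have hklt : ∀ i, t i ≠ 0 → k (t i) < S := fun i hi => by
    have := htmem i
    rw [mem_fil, hk _ hi, O.τ_pow_le_iff] at this
    lia
  have hv : ∀ i, t i ≠ 0 → O.v (t i * O.b i ^ S) = O.τ ^ (k (t i) + S * O.wt i) := fun i hi => by
    rw [map_mul, map_pow, O.v_b, hk _ hi, ← pow_mul, ← pow_add, mul_comm S]
  have hne0 : ∀ i, t i * O.b i ^ S ≠ 0 → t i ≠ 0 := fun i h h0 => h (by rw [h0, zero_mul])
  set R := ∑ i, t i * O.b i ^ S with hRdef
  obtain ⟨j, -, -, hvR, -⟩ := O.v.exists_map_sum_eq_pow O.one_lt_τ Finset.univ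
    (fun i : O.idx m => t i * O.b i ^ S) (fun i => k (t i) + S * O.wt i)
    (fun i _ h => hv i (hne0 i h))
    (fun i _ j _ hi hj h => by
      have h1 := hklt i (hne0 i hi)
      have h2 := hklt j (hne0 j hj)
      have h3 := congrArg (· / S) h
      simp only [Nat.add_mul_div_left _ _ hS0, Nat.div_eq_of_lt h1, Nat.div_eq_of_lt h2,
        zero_add] at h3
      exact Subtype.ext (O.wt_injective h3))
    ⟨i₀, Finset.mem_univ _, fun h => by
      have := hv i₀ hi₀
      rw [h, map_zero] at this
      exact O.τ_pow_ne_zero _ this.symm⟩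
  have hR0 : R ≠ 0 := fun h => by
    rw [← hRdef, h, map_zero] at hvR
    exact O.τ_pow_ne_zero _ hvR.symm
  have hRmem : R ∈ O.fil (l + m * S) := by
    refine sum_mem fun i _ => O.mul_mem_fil (htmem i) (O.pow_mem_fil ?_ S)
    rw [mem_fil, O.v_b, O.τ_pow_le_iff]
    exact i.2
  have hzero : ∀ P ∈ T, P R = 0 := by
    intro P _
    have hfix : ∀ x : K, x ^ (S * S) = x := fun x => by
      have : Fintype K := Fintype.ofFinite K
      rw [← sq, ← hK, Nat.card_eq_fintype_card, FiniteField.pow_card]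
    have h1 : P R ^ S = 0 := by
      rw [hRdef, map_sum, hS, sum_pow_char_pow, ← hS, ← map_zero P, ← htsum, map_sum]
      refine Finset.sum_congr rfl fun i _ => ?_
      rw [map_mul, map_mul, map_pow, map_pow, mul_pow, ← pow_mul, hfix]
    exact pow_eq_zero_iff hS0.ne' |>.1 h1
  have := O.card_zeros_le hR0 hRmem T hzero
  have e : l + m * S + O.c = S ^ 2 + 2 * O.c * S + (S - 1) + O.c := by rw [hm, hl]; ring
  have e' : (2 * O.c + 1) * S = 2 * O.c * S + S := by ring
  lia

end OnePlaceRing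

/-- A field extension of `K(z)` that is algebraically closed carries a valuation with a pole at
the transcendental element `z`. -/
theorem exists_valuation_one_lt (K L : Type*) [Field K] [Field L] [Algebra K L] {z : L}
    (hz : Transcendental K z) :
    ∃ V : ValuationSubring L, 1 < V.valuation z ∧
      ∀ x : K, x ≠ 0 → V.valuation (algebraMap K L x) = 1 := by
  have hzn : z ∉ (integralClosure K L).toSubring := fun h =>
    hz (IsIntegral.isAlgebraic (mem_integralClosure_iff _ _ |>.1 h))
  have : IsIntegrallyClosedIn (integralClosure K L).toSubring L :=
    inferInstanceAs (IsIntegrallyClosedIn (integralClosure K L) L)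
  obtain ⟨V, hV, hzV⟩ := Subring.exists_le_valuationSubring_of_isIntegrallyClosedIn hzn
  have hle : ∀ x : K, V.valuation (algebraMap K L x) ≤ 1 := fun x =>
    (V.valuation_le_one_iff _).2 (hV ((integralClosure K L).algebraMap_mem x))
  refine ⟨V, not_le.1 fun h => hzV ((V.valuation_le_one_iff z).1 h), fun x hx => ?_⟩
  refine le_antisymm (hle x) ?_
  have h := hle x⁻¹
  rw [map_inv₀, map_inv₀] at h
  have h0 : V.valuation (algebraMap K L x) ≠ 0 := by simpa using hx
  exact (inv_le_one₀ (zero_lt_iff.2 h0)).1 h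

namespace KummerArtinSchreier

universe u

variable {K : Type*} [Field K]

/-- The right-hand side of the affine equation `w ^ Q - z ^ (Q - 1) w = rhs z`. -/
def rhs (Q : ℕ) (α γ β : K) : K[X] := C α * X ^ (2 * Q - 1) - C γ * X ^ Q + C β * X

/-- The polynomial `w ^ Q - z ^ (Q - 1) w - rhs z` in `w` over `K[z]`. -/
def eqn (Q : ℕ) (α γ β : K) : K[X][X] :=
  X ^ Q - (C (X ^ (Q - 1)) * X + C (rhs Q α γ β))

variable {Q : ℕ} (α γ β : K)

theorem degree_eqn_tail_lt (hQ : 2 ≤ Q) :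
    (C (X ^ (Q - 1)) * X + C (rhs Q α γ β) : K[X][X]).degree < Q := by
  refine lt_of_le_of_lt degree_linear_le ?_
  exact_mod_cast (by lia : 1 < Q)

theorem monic_eqn (hQ : 2 ≤ Q) : (eqn Q α γ β).Monic :=
  monic_X_pow_sub (by
    have := degree_eqn_tail_lt α γ β hQ
    obtain ⟨n, rfl⟩ : ∃ n, Q = n + 1 := ⟨Q - 1, by lia⟩
    exact this)

theorem natDegree_eqn (hQ : 2 ≤ Q) : (eqn Q α γ β).natDegree = Q := by
  rw [eqn, natDegree_sub_eq_left_of_natDegree_lt, natDegree_X_pow]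
  rw [natDegree_X_pow]
  exact natDegree_linear_le.trans_lt (by lia)

/-- The pole order of `z ^ i * w ^ j`. -/
def weight (Q : ℕ) {d : ℕ} (ij : ℕ × Fin d) : ℕ := Q * ij.1 + (2 * Q - 1) * ij.2

theorem weight_injective (hQ : 2 ≤ Q) {d : ℕ} (hd : d = Q) :
    Function.Injective (weight Q (d := d)) := by
  subst hd
  rintro ⟨i, j⟩ ⟨i', j'⟩ h
  have hj := j.2
  have hj' := j'.2
  simp only [weight] at h
  have e : 2 * d - 1 = d + (d - 1) := by lia
  obtain ⟨m, hm⟩ : ∃ m, d = m + 1 := ⟨d - 1, by lia⟩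
  have key : (j : ℕ) = j' := by
    zify [show 1 ≤ 2 * d by lia] at h
    have h1 : (d : ℤ) ∣ (j : ℤ) - j' := ⟨(i - i') + 2 * (j - j'), by linarith⟩
    have h2 := Int.eq_zero_of_abs_lt_dvd h1 (by rw [abs_lt]; constructor <;> lia)
    lia
  rw [key] at h
  have : i = i' := by
    have := Nat.add_right_cancel h
    exact Nat.eq_of_mul_eq_mul_left (by lia) this
  exact Prod.ext this (Fin.ext key)

theorem exists_weight_eq (hQ : 2 ≤ Q) {d : ℕ} (hd : d = Q) (m : ℕ) (hm : 2 * Q ^ 2 ≤ m) :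
    ∃ ij : ℕ × Fin d, weight Q ij = m := by
  subst hd
  have hd0 : 0 < d := by lia
  set j := (d - m % d) % d with hj
  have hjlt : j < d := Nat.mod_lt _ hd0
  have hle : (2 * d - 1) * j ≤ m := by
    have : (2 * d - 1) * j ≤ (2 * d) * d := Nat.mul_le_mul (by lia) hjlt.le
    nlinarith
  have hdvd : d ∣ m - (2 * d - 1) * j := by
    zify [hle, show 1 ≤ 2 * d by lia]
    have h1 : (d : ℤ) ∣ (m : ℤ) + j := by
      have : d ∣ m + j := by
        rw [Nat.dvd_iff_mod_eq_zero, hj, Nat.add_mod, Nat.mod_mod, ← Nat.add_mod]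
        have h2 := Nat.mod_lt m hd0
        have h3 : m + (d - m % d) = d * (m / d) + d := by
          have := Nat.div_add_mod m d
          lia
        rw [h3]; simp
      exact_mod_cast this
    have e : (m : ℤ) - (2 * d - 1) * j = (m + j) - d * (2 * j) := by ring
    rw [e]
    exact dvd_sub h1 (dvd_mul_right _ _)
  obtain ⟨i, hi⟩ := hdvd
  refine ⟨(i, ⟨j, hjlt⟩), ?_⟩
  simp only [weight]
  lia

theorem exists_onePlaceRing {K : Type u} [Field K] (α γ β : K) (hQ : 2 ≤ Q) (hα : α ≠ 0) :
    ∃ (Γ₀ : Type u) (_ : LinearOrderedCommGroupWithZero Γ₀)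
      (O : OnePlaceRing K (AdjoinRoot (eqn Q α γ β)) (ℕ × Fin (eqn Q α γ β).natDegree) Γ₀),
      O.c = 2 * Q ^ 2 := by
  have hmon := monic_eqn α γ β hQ
  let L := AlgebraicClosure (RatFunc K)
  let z : L := algebraMap (RatFunc K) L RatFunc.X
  have hz : Transcendental K z :=
    (transcendental_algebraMap_iff (algebraMap (RatFunc K) L).injective).2 RatFunc.transcendental_X
  obtain ⟨V, hV, hVK⟩ := exists_valuation_one_lt K L hz
  let φ : K[X] →+* L := (aeval z : K[X] →ₐ[K] L)
  obtain ⟨w, hw⟩ : ∃ w : L, (eqn Q α γ β).eval₂ φ w = 0 := by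
    have hdeg : ((eqn Q α γ β).map φ).degree ≠ 0 := by
      rw [hmon.degree_map, degree_eq_natDegree hmon.ne_zero, natDegree_eqn α γ β hQ]
      exact_mod_cast (by lia : Q ≠ 0)
    obtain ⟨w, hw⟩ := IsAlgClosed.exists_root _ hdeg
    exact ⟨w, by rwa [IsRoot, eval_map] at hw⟩
  let ι : AdjoinRoot (eqn Q α γ β) →+* L := AdjoinRoot.lift φ w hw
  have hweq : w ^ Q = z ^ (Q - 1) * w + φ (rhs Q α γ β) := by
    have := hw
    simp only [eqn, eval₂_sub, eval₂_pow, eval₂_X, eval₂_add, eval₂_mul, eval₂_C] at this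
    rw [sub_eq_zero] at this
    rw [this]
    simp [φ]
  set ζ := V.valuation z with hζ
  have hζ0 : ζ ≠ 0 := (zero_lt_one.trans hV).ne'
  have hCle : ∀ x : K, V.valuation (algebraMap K L x) ≤ 1 := fun x => by
    by_cases hx : x = 0
    · simp [hx]
    · exact (hVK x hx).le
  have hlow : V.valuation (-(algebraMap K L γ * z ^ Q) + algebraMap K L β * z) ≤ ζ ^ Q := by
    refine Valuation.map_add_le _ ?_ ?_
    · rw [Valuation.map_neg, map_mul, map_pow]
      exact mul_le_of_le_one_left' (hCle _)
    · rw [map_mul]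
      refine (mul_le_of_le_one_left' (hCle _)).trans ?_
      exact le_self_pow₀ hV.le (by lia)
  have hrhs : V.valuation (φ (rhs Q α γ β)) = ζ ^ (2 * Q - 1) := by
    have e : φ (rhs Q α γ β) = algebraMap K L α * z ^ (2 * Q - 1) +
        (-(algebraMap K L γ * z ^ Q) + algebraMap K L β * z) := by
      simp only [rhs, φ, RingHom.coe_coe, map_add, map_sub, map_mul, map_pow, aeval_X, aeval_C]
      ring
    have h1 : V.valuation (algebraMap K L α * z ^ (2 * Q - 1)) = ζ ^ (2 * Q - 1) := by
      rw [map_mul, hVK α hα, one_mul, map_pow]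
    rw [e, Valuation.map_add_eq_of_lt_left, h1]
    rw [h1]
    exact hlow.trans_lt (pow_lt_pow_right₀ hV (by lia))
  have hwζ : ζ < V.valuation w := by
    by_contra! hle
    have h1 : V.valuation (φ (rhs Q α γ β)) ≤ ζ ^ Q := by
      have e : φ (rhs Q α γ β) = w ^ Q - z ^ (Q - 1) * w := by rw [hweq]; ring
      rw [e]
      refine Valuation.map_sub_le _ ?_ ?_
      · rw [map_pow]; exact pow_le_pow_left' hle Q
      · rw [map_mul, map_pow]
        calc ζ ^ (Q - 1) * V.valuation w ≤ ζ ^ (Q - 1) * ζ := mul_le_mul_right hle _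
          _ = ζ ^ Q := by rw [← pow_succ]; congr 1; lia
    rw [hrhs] at h1
    exact absurd h1 (not_le.2 (pow_lt_pow_right₀ hV (by lia)))
  have hw0 : V.valuation w ≠ 0 := (zero_lt_one.trans (hV.trans hwζ)).ne'
  have hwQ : V.valuation w ^ Q = ζ ^ (2 * Q - 1) := by
    have e : φ (rhs Q α γ β) = w ^ Q - z ^ (Q - 1) * w := by rw [hweq]; ring
    rw [← hrhs, e, Valuation.map_sub_eq_of_lt_left, map_pow]
    rw [map_mul, map_pow, map_pow]
    calc ζ ^ (Q - 1) * V.valuation w < V.valuation w ^ (Q - 1) * V.valuation w :=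
          mul_lt_mul_of_pos_right (pow_lt_pow_left₀ hwζ zero_le (by lia)) (zero_lt_iff.2 hw0)
      _ = V.valuation w ^ Q := by rw [← pow_succ]; congr 1; lia
  set τ := ζ ^ 2 / V.valuation w with hτdef
  have hτQ : τ ^ Q = ζ := by
    rw [hτdef, div_pow, hwQ, div_eq_iff (pow_ne_zero _ hζ0), ← pow_mul, ← pow_succ']
    congr 1; lia
  have hτ0 : τ ≠ 0 := div_ne_zero (pow_ne_zero _ hζ0) hw0
  have hτw : V.valuation w = τ ^ (2 * Q - 1) := by
    have h1 : τ * V.valuation w = τ ^ (2 * Q) := by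
      rw [mul_comm 2 Q, pow_mul, hτQ, hτdef, div_mul_cancel₀ _ hw0]
    refine mul_left_cancel₀ hτ0 ?_
    rw [h1, ← pow_succ']; congr 1; lia
  have hτ1 : 1 < τ := by
    by_contra! h
    have := pow_le_one' h Q
    rw [hτQ] at this
    exact absurd this (not_le.2 hV)
  let b := (basisMonomials K).smulTower (AdjoinRoot.powerBasis' hmon).basis
  refine ⟨V.ValueGroup, inferInstance, {
    v := V.valuation.comap ι
    τ := τ
    b := b
    wt := weight Q
    c := 2 * Q ^ 2
    one_lt_τ := hτ1
    v_algebraMap := ?_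
    v_b := ?_
    wt_injective := weight_injective hQ (natDegree_eqn α γ β hQ)
    exists_wt_eq := exists_weight_eq hQ (natDegree_eqn α γ β hQ) }, rfl⟩
  · intro x hx
    rw [Valuation.comap_apply, ← hVK x hx, IsScalarTower.algebraMap_apply K K[X],
      AdjoinRoot.algebraMap_eq, AdjoinRoot.lift_of]
    simp [φ]
  · rintro ⟨i, j⟩
    have e : b (i, j) = AdjoinRoot.of _ (X ^ i) * AdjoinRoot.root _ ^ (j : ℕ) := by
      rw [Module.Basis.smulTower_apply, Algebra.smul_def, PowerBasis.coe_basis]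
      simp [X_pow_eq_monomial]
    have e' : ι (b (i, j)) = z ^ i * w ^ (j : ℕ) := by
      rw [e, map_mul, map_pow ι (AdjoinRoot.root _), AdjoinRoot.lift_root, AdjoinRoot.lift_of]
      simp [φ]
    refine (congrArg V.valuation e').trans ?_
    rw [map_mul, map_pow, map_pow, hτw, weight, pow_add, pow_mul,
      pow_mul, hτQ]

/-- The number of points of `y ^ Q - y = α z ^ (Q - 1) - γ + β z ^ (1 - Q)` over a field with
`S ^ 2` elements is at most `S ^ 2 + O(S)`. -/
theorem card_points_le [Finite K] (p e S : ℕ) [Fact p.Prime] [CharP K p]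
    (hS : S = p ^ e) (hK : Nat.card K = S ^ 2) (hQ : 2 ≤ Q) (hα : α ≠ 0)
    (hlarge : (2 * Q ^ 2) ^ 2 + 3 * (2 * Q ^ 2) + 1 < S) (T : Finset (K × K))
    (hT : ∀ t ∈ T, t.1 ≠ 0 ∧ t.2 ^ Q - t.2 = α * t.1 ^ (Q - 1) - γ + β * (t.1 ^ (Q - 1))⁻¹) :
    T.card ≤ S ^ 2 + (2 * (2 * Q ^ 2) + 1) * S + 2 * Q ^ 2 := by
  classical
  obtain ⟨Γ₀, _, O, hc⟩ := exists_onePlaceRing α γ β hQ hα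
  have hroot : ∀ t : T, (eqn Q α γ β).eval₂ (aeval (t : K × K).1 : K[X] →ₐ[K] K).toRingHom
      ((t : K × K).1 * (t : K × K).2) = 0 := by
    rintro ⟨⟨z, y⟩, ht⟩
    obtain ⟨hz, hy⟩ := hT _ ht
    simp only at hz hy
    have hy' : y ^ Q = y + (α * z ^ (Q - 1) - γ + β * (z ^ (Q - 1))⁻¹) := by rw [← hy]; ring
    simp only [eqn, rhs, eval₂_sub, eval₂_pow, eval₂_X, eval₂_add, eval₂_mul, eval₂_C,
      AlgHom.toRingHom_eq_coe, RingHom.coe_coe, map_pow, map_sub, map_add, map_mul, aeval_X,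
      aeval_C, Algebra.algebraMap_self_apply, mul_pow, hy']
    obtain ⟨m, rfl⟩ : ∃ m, Q = m + 1 := ⟨Q - 1, by lia⟩
    have e1 : 2 * (m + 1) - 1 = m + (m + 1) := by lia
    have e2 : m + 1 - 1 = m := by lia
    rw [e1, e2]
    have hzm : z ^ m ≠ 0 := pow_ne_zero _ hz
    field_simp
    ring
  let ev : T → (AdjoinRoot (eqn Q α γ β) →ₐ[K] K) := fun t =>
    { AdjoinRoot.lift (aeval (t : K × K).1 : K[X] →ₐ[K] K).toRingHom _ (hroot t) with
      commutes' := fun x => by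
        rw [IsScalarTower.algebraMap_apply K K[X], AdjoinRoot.algebraMap_eq]
        simp }
  have hev1 : ∀ t : T, ev t (AdjoinRoot.of _ X) = (t : K × K).1 := fun t => by
    change AdjoinRoot.lift _ _ (hroot t) _ = _
    simp
  have hev2 : ∀ t : T, ev t (AdjoinRoot.root _) = (t : K × K).1 * (t : K × K).2 := fun t => by
    change AdjoinRoot.lift _ _ (hroot t) _ = _
    simp
  have hinj : Function.Injective ev := by
    intro t t' h
    have h1 : (t : K × K).1 = (t' : K × K).1 := by rw [← hev1, h, hev1]
    have h2 : (t : K × K).1 * (t : K × K).2 = (t' : K × K).1 * (t' : K × K).2 := by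
      rw [← hev2, h, hev2]
    rw [← h1] at h2
    exact Subtype.ext (Prod.ext h1 (mul_left_cancel₀ (hT _ t.2).1 h2))
  have := O.card_points_le p e S hS hK (by rw [hc]; exact hlarge) (Finset.univ.image ev)
  rwa [Finset.card_image_of_injective _ hinj, Finset.card_univ, Fintype.card_coe, hc] at this

end KummerArtinSchreier

namespace FiniteField

variable {F L : Type} [Field F] [Fintype F] [Field L] [Finite L] [Algebra F L]

theorem mem_zpowers_frobenius (g : Gal(L/F)) :
    g ∈ Subgroup.zpowers (frobeniusAlgEquivOfAlgebraic F L) :=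
  have ⟨n, hn⟩ := (bijective_frobeniusAlgEquivOfAlgebraic_pow F L).2 g
  ⟨n, by simpa using hn⟩

theorem exists_pow_card_sub_one_eq {x : L} (hx : Algebra.norm F x = 1) :
    ∃ z : Lˣ, (z : L) ^ (Fintype.card F - 1) = x := by
  obtain ⟨y, hy⟩ := groupCohomology.exists_div_of_norm_eq_one mem_zpowers_frobenius hx
  refine ⟨y⁻¹, ?_⟩
  have hc : Fintype.card F - 1 + 1 = Fintype.card F := Nat.succ_pred_eq_of_pos Fintype.card_pos
  rw [← hy, coe_frobeniusAlgEquivOfAlgebraic]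
  simp only
  rw [← hc, pow_succ]
  have := y.ne_zero
  simp only [Units.val_inv_eq_inv_val, inv_pow, add_tsub_cancel_right]
  field_simp

theorem mem_range_algebraMap_of_pow_card_eq {y : L} (hy : y ^ Fintype.card F = y) :
    y ∈ Set.range (algebraMap F L) := by
  rw [IsGalois.mem_range_algebraMap_iff_fixed]
  intro g
  have hfix : frobeniusAlgEquivOfAlgebraic F L ∈ MulAction.stabilizer Gal(L/F) y := hy
  exact (Subgroup.zpowers_le.2 hfix) (mem_zpowers_frobenius g)

theorem exists_pow_card_sub_self_eq {x : L} (hx : Algebra.trace F L x = 0) :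
    ∃ y : L, y ^ Fintype.card F - y = x := by
  let φ : L →ₗ[F] L := (frobeniusAlgEquivOfAlgebraic F L).toLinearMap - LinearMap.id
  have hφ : ∀ y, φ y = y ^ Fintype.card F - y := fun y => rfl
  have hle : LinearMap.range φ ≤ LinearMap.ker (Algebra.trace F L) := by
    rintro _ ⟨y, rfl⟩
    rw [LinearMap.mem_ker]
    change Algebra.trace F L (frobeniusAlgEquivOfAlgebraic F L y - y) = 0
    rw [map_sub, Algebra.trace_eq_of_algEquiv, sub_self]
  have hker : Module.finrank F (LinearMap.ker φ) ≤ 1 := by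
    have hle : LinearMap.ker φ ≤ LinearMap.range (Algebra.linearMap F L) := by
      intro y hy
      exact mem_range_algebraMap_of_pow_card_eq (sub_eq_zero.1 hy)
    refine (Submodule.finrank_mono hle).trans ((LinearMap.finrank_range_le _).trans ?_)
    simp
  have h1 := φ.finrank_range_add_finrank_ker
  have h2 := (Algebra.trace F L).finrank_range_add_finrank_ker
  rw [LinearMap.range_eq_top.2 (Algebra.trace_surjective F L), finrank_top,
    Module.finrank_self] at h2
  have heq := Submodule.eq_of_le_of_finrank_le hle (by lia)
  have : x ∈ LinearMap.range φ := by rw [heq]; exact hx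
  exact this

/-- Upper bound for the number of elements `x` of a large extension with prescribed norm and
prescribed trace of `x + b / x`. -/
theorem card_norm_trace_le [DecidableEq F] [Fintype Lˣ] (S p e : ℕ) [Fact p.Prime] [CharP L p]
    (hS : S = p ^ e) (hL : Nat.card L = S ^ 2)
    (hlarge : (2 * Fintype.card F ^ 2) ^ 2 + 3 * (2 * Fintype.card F ^ 2) + 1 < S)
    (b v : F) (u : Fˣ) :
    Fintype.card F * (Fintype.card F - 1) *
      (Finset.univ.filter fun x : Lˣ => Units.map (Algebra.norm F) x = u ∧
        Algebra.trace F L (x + b • (x : L)⁻¹) = v).card ≤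
      S ^ 2 + (4 * Fintype.card F ^ 2 + 1) * S + 2 * Fintype.card F ^ 2 := by
  classical
  set Q := Fintype.card F with hQdef
  set Z := Finset.univ.filter fun x : Lˣ => Units.map (Algebra.norm F) x = u ∧
        Algebra.trace F L (x + b • (x : L)⁻¹) = v with hZ
  have hQ : 2 ≤ Q := Fintype.one_lt_card
  have hchar : ExpChar L p := ExpChar.prime Fact.out
  have hQp : ∃ m, Q = p ^ m := by
    have : CharP F p := (Algebra.charP_iff F L p).2 inferInstance
    obtain ⟨m, -, hm⟩ := FiniteField.card F p
    exact ⟨m, hm⟩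
  have hfrob : ∀ x y : L, (x + y) ^ Q = x ^ Q + y ^ Q := by
    obtain ⟨m, hm⟩ := hQp
    intro x y
    rw [hm, add_pow_expChar_pow]
  have hmapQ : ∀ a : F, algebraMap F L a ^ Q = algebraMap F L a := fun a => by
    rw [← map_pow, FiniteField.pow_card]
  have hmapQ1 : ∀ a : Fˣ, algebraMap F L a ^ (Q - 1) = 1 := fun a => by
    rw [← map_pow, FiniteField.pow_card_sub_one_eq_one _ a.ne_zero, map_one]
  obtain hempty | ⟨c, hc⟩ := Z.eq_empty_or_nonempty
  · simp [hempty]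
  obtain ⟨hcN, hcT⟩ := (Finset.mem_filter.1 hc).2
  have hz : ∀ x : Z, ∃ z : Lˣ, (x : Lˣ) = (c : L) * (z : L) ^ (Q - 1) := by
    rintro ⟨x, hx⟩
    obtain ⟨hxN, -⟩ := (Finset.mem_filter.1 hx).2
    have hN : Algebra.norm F (x / c : L) = 1 := by
      have h1 := congrArg Units.val (hxN.trans hcN.symm)
      simp only [Units.coe_map] at h1
      have h2 : Algebra.norm F (c : L) ≠ 0 := by simp
      rw [div_eq_mul_inv, map_mul, Algebra.norm_inv, h1, mul_inv_cancel₀ h2]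
    obtain ⟨z, hz⟩ := exists_pow_card_sub_one_eq hN
    exact ⟨z, by rw [hz, mul_div_cancel₀]; exact c.ne_zero⟩
  have hy : ∀ x : Z, ∃ y : L, y ^ Q - y =
      ((x : Lˣ) + b • ((x : Lˣ) : L)⁻¹) - (c + b • (c : L)⁻¹ : L) := by
    rintro ⟨x, hx⟩
    obtain ⟨-, hxT⟩ := (Finset.mem_filter.1 hx).2
    exact exists_pow_card_sub_self_eq (by rw [map_sub, hxT, hcT, sub_self])
  choose z hz using hz
  choose y hy using hy
  let f : Z × Fˣ × F → L × L := fun t =>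
    (algebraMap F L t.2.1 * z t.1, y t.1 + algebraMap F L t.2.2)
  have hfz : ∀ t, (c : L) * (f t).1 ^ (Q - 1) = ((t.1 : Lˣ) : L) := fun t => by
    simp only [f]
    rw [mul_pow, hmapQ1, one_mul, hz]
  have hf : Function.Injective f := by
    rintro ⟨x, l, m⟩ ⟨x', l', m'⟩ h
    have hx : x = x' := by
      apply Subtype.ext
      apply Units.ext
      rw [← hfz (x, l, m), ← hfz (x', l', m'), h]
    subst hx
    simp only [f, Prod.mk.injEq, mul_eq_mul_right_iff, Units.ne_zero, or_false, add_right_inj,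
      (algebraMap F L).injective.eq_iff] at h
    rw [Units.ext h.1, h.2]
  have key := KummerArtinSchreier.card_points_le (K := L) (c : L) (c + b • (c : L)⁻¹ : L)
    (b • (c : L)⁻¹) p e S hS hL hQ c.ne_zero hlarge (Finset.univ.image f) (by
      intro t ht
      obtain ⟨t, -, rfl⟩ := Finset.mem_image.1 ht
      refine ⟨mul_ne_zero (by simp) (Units.ne_zero _), ?_⟩
      have h1 : b • (c : L)⁻¹ * ((f t).1 ^ (Q - 1))⁻¹ = b • (((t.1 : Lˣ) : L))⁻¹ := by
        rw [smul_mul_assoc, ← mul_inv, hfz]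
      rw [h1, hfz]
      simp only [f]
      rw [hfrob, hmapQ, add_sub_add_right_eq_sub, hy]
      ring)
  rw [Finset.card_image_of_injective _ hf, Finset.card_univ, Fintype.card_prod, Fintype.card_prod,
    Fintype.card_coe, Fintype.card_units] at key
  calc _ = Z.card * ((Q - 1) * Q) := by ring
    _ ≤ _ := key
    _ = _ := by ring

end FiniteField

/-- The Kloosterman sum `∑ χ(x) ψ₁(x) ψ₂(x⁻¹)` over the nonzero elements of a finite field. -/
def kloostermanSum {F : Type} [Field F] [Fintype Fˣ] (χ : Fˣ →* ℂ) (ψ₁ ψ₂ : AddChar F ℂ) : ℂ :=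
  ∑ x : Fˣ, χ x * (ψ₁ x * ψ₂ (x⁻¹ : Fˣ))

theorem norm_unitsHom_apply {G : Type*} [Group G] [Finite G] (χ : G →* ℂ) (x : G) : ‖χ x‖ = 1 := by
  exact (MonoidHom.isOfFinOrder χ (isOfFinOrder_of_finite x)).norm_eq_one

/-- The trace lift of an additive character. -/
def AddChar.traceLift {F : Type} (L : Type) [Field F] [Field L] [Algebra F L] (ψ : AddChar F ℂ) :
    AddChar L ℂ := ψ.compAddMonoidHom (Algebra.trace F L).toAddMonoidHom

@[simp]
theorem AddChar.traceLift_apply {F L : Type} [Field F] [Field L] [Algebra F L] (ψ : AddChar F ℂ)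
    (x : L) : ψ.traceLift L x = ψ (Algebra.trace F L x) := rfl

/-- The norm lift of a multiplicative character. -/
def MonoidHom.normLift {F : Type} (L : Type) [Field F] [Field L] [Algebra F L] (χ : Fˣ →* ℂ) :
    Lˣ →* ℂ := χ.comp (Units.map (Algebra.norm F : L →* F))

@[simp]
theorem MonoidHom.normLift_apply {F L : Type} [Field F] [Field L] [Algebra F L] (χ : Fˣ →* ℂ)
    (x : Lˣ) : χ.normLift L x = χ (Units.map (Algebra.norm F : L →* F) x) := rfl

theorem norm_kloostermanSum_lift_le {F L : Type} [Field F] [Fintype F] [Field L] [Fintype L]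
    [Fintype Lˣ] [Algebra F L] (S p e : ℕ) [Fact p.Prime] [CharP L p]
    (hS : S = p ^ e) (hL : Nat.card L = S ^ 2)
    (hlarge : (2 * Fintype.card F ^ 2) ^ 2 + 3 * (2 * Fintype.card F ^ 2) + 1 < S)
    (χ : Fˣ →* ℂ) {ψ : AddChar F ℂ} (hψ : ψ ≠ 1) (b : F) :
    ‖kloostermanSum (χ.normLift L) (ψ.traceLift L) ((ψ.mulShift b).traceLift L)‖ ≤
      (4 * Fintype.card F ^ 2 + 1) * S + 2 * Fintype.card F ^ 2 + 1 := by
  classical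
  set Q := Fintype.card F with hQ
  let Z : Fˣ × F → ℕ := fun w => (Finset.univ.filter fun x : Lˣ =>
    Units.map (Algebra.norm F) x = w.1 ∧ Algebra.trace F L (x + b • (x : L)⁻¹) = w.2).card
  have hQ2 : 2 ≤ Q := Fintype.one_lt_card
  have hD : (0 : ℝ) < Q * (Q - 1) := by
    have : (2 : ℝ) ≤ Q := by exact_mod_cast hQ2
    nlinarith
  let B : ℝ := S ^ 2 + (4 * Q ^ 2 + 1) * S + 2 * Q ^ 2
  let a : ℝ := B / (Q * (Q - 1))
  have hZ : ∀ w, (Z w : ℝ) ≤ a := fun w => by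
    have h := FiniteField.card_norm_trace_le S p e hS hL hlarge b w.2 w.1
    rw [le_div_iff₀ hD]
    have h' : ((Q * (Q - 1) * Z w : ℕ) : ℝ) ≤ B := (Nat.cast_le.2 h).trans_eq (by simp [B, hQ])
    push_cast [show 1 ≤ Q by lia] at h'
    linarith
  let g : Lˣ → Fˣ × F := fun x =>
    (Units.map (Algebra.norm F) x, Algebra.trace F L (x + b • (x : L)⁻¹))
  have hfib : ∀ w, (Finset.univ.filter fun x => g x = w).card = Z w := fun w => by
    simp only [Z, g, Prod.ext_iff]
  have hsum : kloostermanSum (χ.normLift L) (ψ.traceLift L) ((ψ.mulShift b).traceLift L) =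
      ∑ w : Fˣ × F, (χ w.1 * ψ w.2) * (Z w : ℂ) := by
    have : kloostermanSum (χ.normLift L) (ψ.traceLift L) ((ψ.mulShift b).traceLift L) =
        ∑ x : Lˣ, χ (g x).1 * ψ (g x).2 := by
      refine Finset.sum_congr rfl fun x _ => ?_
      simp only [MonoidHom.normLift_apply, AddChar.traceLift_apply, AddChar.mulShift_apply, g,
        map_add, map_smul, AddChar.map_add_eq_mul, smul_eq_mul, Units.val_inv_eq_inv_val]
    rw [this, ← Finset.sum_fiberwise_of_maps_to (t := Finset.univ) (g := g) (by simp)]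
    refine Finset.sum_congr rfl fun w _ => ?_
    rw [← hfib w, mul_comm, ← nsmul_eq_mul, ← Finset.sum_const]
    refine Finset.sum_congr rfl fun x hx => ?_
    rw [(Finset.mem_filter.1 hx).2]
  have hzero : ∑ w : Fˣ × F, (χ w.1 * ψ w.2) * (a : ℂ) = 0 := by
    rw [← Finset.sum_mul, Fintype.sum_prod_type]
    simp only [← Finset.mul_sum]
    rw [AddChar.sum_eq_zero_of_ne_one hψ]
    simp
  have htot : ∑ w, (Z w : ℝ) = S ^ 2 - 1 := by
    have : ∑ w, Z w = S ^ 2 - 1 := by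
      simp only [← hfib]
      rw [← Finset.card_eq_sum_card_fiberwise (by simp), Finset.card_univ,
        ← Nat.card_eq_fintype_card, Nat.card_units, hL]
    have hS1 : 1 ≤ S ^ 2 := by rw [← hL]; exact Nat.card_pos
    rw [← Nat.cast_sum, this]
    push_cast [hS1]
    ring
  have hcard : ((Fintype.card (Fˣ × F) : ℕ) : ℝ) = Q * (Q - 1) := by
    rw [Fintype.card_prod, Fintype.card_units, ← hQ]
    push_cast [show 1 ≤ Q by lia]
    ring
  calc _ = ‖∑ w : Fˣ × F, (χ w.1 * ψ w.2) * ((Z w : ℂ) - a)‖ := by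
        simp only [mul_sub, Finset.sum_sub_distrib, hzero, sub_zero, hsum]
    _ ≤ ∑ w : Fˣ × F, (a - Z w) := by
        refine norm_sum_le_of_le _ fun w _ => ?_
        rw [norm_mul, norm_mul, norm_unitsHom_apply, AddChar.norm_apply, one_mul, one_mul,
          norm_sub_rev]
        have e : (a : ℂ) - (Z w : ℂ) = ((a - Z w : ℝ) : ℂ) := by push_cast; rfl
        rw [e, Complex.norm_real, Real.norm_of_nonneg (sub_nonneg.2 (hZ w))]
    _ = B - (S ^ 2 - 1) := by
        rw [Finset.sum_sub_distrib, htot, Finset.sum_const, Finset.card_univ, nsmul_eq_mul, hcard,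
          mul_div_cancel₀ _ hD.ne']
    _ = _ := by simp only [B]; ring

section Quadratic

variable {E L : Type} [Field E] [Field L] [Fintype E] [Fintype L] [Algebra E L]

theorem algebraMap_trace_of_finrank_two (h2 : Module.finrank E L = 2) (z : L) :
    algebraMap E L (Algebra.trace E L z) = z + z ^ Fintype.card E := by
  rw [FiniteField.algebraMap_trace_eq_sum_pow, h2, Nat.card_eq_fintype_card]
  simp [Finset.sum_range_succ]

theorem algebraMap_norm_of_finrank_two (h2 : Module.finrank E L = 2) (z : L) :
    algebraMap E L (Algebra.norm E z) = z * z ^ Fintype.card E := by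
  rw [FiniteField.algebraMap_norm_eq_prod_pow, h2, Nat.card_eq_fintype_card]
  simp [Finset.prod_range_succ]

variable [DecidableEq E] [DecidableEq L]

/-- The sum and product of a pair of nonzero elements. -/
def sumProd (xy : Eˣ × Eˣ) : E × Eˣ := (xy.1 + xy.2, xy.1 * xy.2)

/-- The trace and norm of a nonzero element. -/
def traceNorm (E : Type) {L : Type} [Field E] [Field L] [Algebra E L] (z : Lˣ) : E × Eˣ :=
  (Algebra.trace E L z, Units.map (Algebra.norm E : L →* E) z)

theorem card_sumProd_add_card_traceNorm_le (h2 : Module.finrank E L = 2) (w : E × Eˣ) :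
    (Finset.univ.filter fun xy => sumProd xy = w).card +
      (Finset.univ.filter fun z : Lˣ => traceNorm E z = w).card ≤ 2 := by
  obtain ⟨s, t⟩ := w
  set A := Finset.univ.filter fun xy : Eˣ × Eˣ => sumProd xy = (s, t) with hA
  set B := Finset.univ.filter fun z : Lˣ => traceNorm E z = (s, t) with hB
  let f : Eˣ × Eˣ → L := fun xy => algebraMap E L xy.1
  let P : L[X] := X ^ 2 - C (algebraMap E L s) * X + C (algebraMap E L t)
  have hPm : P.Monic := by unfold P; monicity!
  have hPd : P.natDegree = 2 := by unfold P; compute_degree!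
  have hroots : P.roots.toFinset.card ≤ 2 :=
    P.roots.toFinset_card_le.trans ((card_roots' P).trans hPd.le)
  have hAmem : ∀ xy ∈ A, (xy.1 : E) + xy.2 = s ∧ (xy.1 : E) * xy.2 = t := fun xy hxy => by
    have := (Finset.mem_filter.1 hxy).2
    simp only [sumProd, Prod.mk.injEq] at this
    exact ⟨this.1, by rw [← this.2]; rfl⟩
  have hBmem : ∀ z ∈ B, (z : L) + (z : L) ^ Fintype.card E = algebraMap E L s ∧
      (z : L) * (z : L) ^ Fintype.card E = algebraMap E L t := fun z hz => by
    have := (Finset.mem_filter.1 hz).2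
    simp only [traceNorm, Prod.mk.injEq] at this
    rw [← algebraMap_trace_of_finrank_two h2, ← algebraMap_norm_of_finrank_two h2, this.1, ← this.2]
    exact ⟨rfl, rfl⟩
  have hfA : A.image f ⊆ P.roots.toFinset := by
    intro x hx
    obtain ⟨xy, hxy, rfl⟩ := Finset.mem_image.1 hx
    obtain ⟨h1, h2⟩ := hAmem xy hxy
    rw [Multiset.mem_toFinset, mem_roots hPm.ne_zero]
    simp only [P, f, IsRoot.def, eval_add, eval_sub, eval_mul, eval_pow, eval_X, eval_C, ← h1, ← h2,
      map_add, map_mul]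
    ring
  have hfB : B.image Units.val ⊆ P.roots.toFinset := by
    intro x hx
    obtain ⟨z, hz, rfl⟩ := Finset.mem_image.1 hx
    obtain ⟨h1, h2⟩ := hBmem z hz
    rw [Multiset.mem_toFinset, mem_roots hPm.ne_zero]
    simp only [P, IsRoot.def, eval_add, eval_sub, eval_mul, eval_pow, eval_X, eval_C, ← h1, ← h2]
    ring
  have hcA : (A.image f).card = A.card := by
    refine Finset.card_image_of_injOn fun xy hxy xy' hxy' h => ?_
    have h1 : xy.1 = xy'.1 := Units.ext ((algebraMap E L).injective h)
    have h3 := (hAmem xy hxy).1.trans (hAmem xy' hxy').1.symm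
    rw [h1] at h3
    exact Prod.ext h1 (Units.ext (add_left_cancel h3))
  have hcB : (B.image Units.val).card = B.card :=
    Finset.card_image_of_injective _ fun _ _ h => Units.ext h
  rw [← hcA, ← hcB]
  by_cases hdisj : Disjoint (A.image f) (B.image Units.val)
  · rw [← Finset.card_union_of_disjoint hdisj]
    exact (Finset.card_le_card (Finset.union_subset hfA hfB)).trans hroots
  · obtain ⟨x, hxA, hxB⟩ := Finset.not_disjoint_iff.1 hdisj
    obtain ⟨⟨a, b⟩, hab, rfl⟩ := Finset.mem_image.1 hxA
    obtain ⟨z, hz, hza⟩ := Finset.mem_image.1 hxB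
    have hpow : (algebraMap E L a) ^ Fintype.card E = algebraMap E L a := by
      rw [← map_pow, FiniteField.pow_card]
    obtain ⟨h1, h3⟩ := hBmem z hz
    rw [hza] at h1 h3
    simp only [f] at h1 h3
    rw [hpow] at h1 h3
    have honly : ∀ x ∈ P.roots.toFinset, x = algebraMap E L a := fun x hx => by
      rw [Multiset.mem_toFinset, mem_roots hPm.ne_zero] at hx
      simp only [P, IsRoot.def, eval_add, eval_sub, eval_mul, eval_pow, eval_X, eval_C, ← h1,
        ← h3] at hx
      have : (x - algebraMap E L a) ^ 2 = 0 := by rw [← hx]; ring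
      exact sub_eq_zero.1 (pow_eq_zero_iff two_ne_zero |>.1 this)
    have hle : ∀ s : Finset L, s ⊆ P.roots.toFinset → s.card ≤ 1 := fun s hs =>
      Finset.card_le_one.2 fun x hx y hy => (honly x (hs hx)).trans (honly y (hs hy)).symm
    exact add_le_add (hle _ hfA) (hle _ hfB)

theorem card_sumProd_add_card_traceNorm (h2 : Module.finrank E L = 2) (w : E × Eˣ) :
    (Finset.univ.filter fun xy => sumProd xy = w).card +
      (Finset.univ.filter fun z : Lˣ => traceNorm E z = w).card = 2 := by
  have hsum : ∑ w : E × Eˣ, ((Finset.univ.filter fun xy => sumProd xy = w).card +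
      (Finset.univ.filter fun z : Lˣ => traceNorm E z = w).card) = ∑ _w : E × Eˣ, 2 := by
    rw [Finset.sum_add_distrib, ← Finset.card_eq_sum_card_fiberwise (by simp),
      ← Finset.card_eq_sum_card_fiberwise (by simp), Finset.sum_const, Finset.card_univ,
      Finset.card_univ, Finset.card_univ, Fintype.card_prod, Fintype.card_prod,
      Fintype.card_units, Fintype.card_units, Module.card_eq_pow_finrank (K := E) (V := L), h2]
    obtain ⟨m, hm⟩ : ∃ m, Fintype.card E = m + 1 := ⟨_, (Nat.succ_pred Fintype.card_ne_zero).symm⟩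
    rw [hm, show (m + 1) ^ 2 - 1 = m ^ 2 + 2 * m by
      rw [add_sq]; simp, Nat.add_sub_cancel, smul_eq_mul]
    ring
  exact (Finset.sum_eq_sum_iff_of_le fun w _ => card_sumProd_add_card_traceNorm_le h2 w).1 hsum w
    (Finset.mem_univ w)

theorem AddChar.mulShift_injective_of_ne_one {E : Type} [Field E] {ψ : AddChar E ℂ} (hψ : ψ ≠ 1) :
    Function.Injective ψ.mulShift :=
  AddChar.to_mulShift_inj_of_isPrimitive (AddChar.IsPrimitive.of_ne_one hψ)

theorem AddChar.exists_eq_mulShift {E : Type} [Field E] [Fintype E] {ψ : AddChar E ℂ}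
    (hψ : ψ ≠ 1) (ψ' : AddChar E ℂ) :
    ∃ b, ψ' = ψ.mulShift b := by
  have : Function.Bijective ψ.mulShift := by
    rw [Fintype.bijective_iff_injective_and_card]
    exact ⟨AddChar.mulShift_injective_of_ne_one hψ, (AddChar.card_eq).symm⟩
  obtain ⟨b, hb⟩ := this.2 ψ'
  exact ⟨b, hb.symm⟩

theorem norm_sq_kloostermanSum_add_le (h2 : Module.finrank E L = 2) (χ : Eˣ →* ℂ)
    {ψ₁ : AddChar E ℂ} (hψ : ψ₁ ≠ 1) (ψ₂ : AddChar E ℂ) :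
    ‖kloostermanSum χ ψ₁ ψ₂ ^ 2 +
      kloostermanSum (χ.normLift L) (ψ₁.traceLift L) (ψ₂.traceLift L)‖ ≤ 2 * Fintype.card E := by
  let G : E × Eˣ → ℂ := fun w => χ w.2 * (ψ₁ w.1 * ψ₂ (w.1 * (w.2 : E)⁻¹))
  have e1 : kloostermanSum χ ψ₁ ψ₂ ^ 2 =
      ∑ w, ((Finset.univ.filter fun xy : Eˣ × Eˣ => sumProd xy = w).card : ℂ) * G w := by
    have : kloostermanSum χ ψ₁ ψ₂ ^ 2 = ∑ xy : Eˣ × Eˣ, G (sumProd xy) := by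
      rw [sq, kloostermanSum, Fintype.sum_mul_sum, Fintype.sum_prod_type]
      refine Finset.sum_congr rfl fun x _ => Finset.sum_congr rfl fun y _ => ?_
      have : ((x : E) + y) * ((x * y : Eˣ) : E)⁻¹ = (x⁻¹ : Eˣ) + (y⁻¹ : Eˣ) := by
        have := x.ne_zero
        have := y.ne_zero
        push_cast
        field_simp
        ring
      simp only [G, sumProd, this, map_mul, AddChar.map_add_eq_mul]
      ring
    rw [this, ← Finset.sum_fiberwise_of_maps_to (t := Finset.univ) (g := sumProd) (by simp)]
    refine Finset.sum_congr rfl fun w _ => ?_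
    rw [← nsmul_eq_mul, ← Finset.sum_const]
    exact Finset.sum_congr rfl fun x hx => by rw [(Finset.mem_filter.1 hx).2]
  have e2 : kloostermanSum (χ.normLift L) (ψ₁.traceLift L) (ψ₂.traceLift L) =
      ∑ w, ((Finset.univ.filter fun z : Lˣ => traceNorm E z = w).card : ℂ) * G w := by
    have : kloostermanSum (χ.normLift L) (ψ₁.traceLift L) (ψ₂.traceLift L) =
        ∑ z : Lˣ, G (traceNorm E z) := by
      refine Finset.sum_congr rfl fun z _ => ?_
      have : Algebra.trace E L (z⁻¹ : Lˣ) =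
          Algebra.trace E L z * (Units.map (Algebra.norm E : L →* E) z : E)⁻¹ := by
        apply (algebraMap E L).injective
        rw [map_mul, map_inv₀, Units.coe_map]
        change _ = _ * (algebraMap E L (Algebra.norm E (z : L)))⁻¹
        rw [algebraMap_trace_of_finrank_two h2, algebraMap_trace_of_finrank_two h2,
          algebraMap_norm_of_finrank_two h2]
        have := z.ne_zero
        push_cast
        rw [inv_pow]
        field_simp
        ring
      simp only [G, traceNorm, MonoidHom.normLift_apply, AddChar.traceLift_apply, this]
    rw [this, ← Finset.sum_fiberwise_of_maps_to (t := Finset.univ) (g := traceNorm E) (by simp)]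
    refine Finset.sum_congr rfl fun w _ => ?_
    rw [← nsmul_eq_mul, ← Finset.sum_const]
    exact Finset.sum_congr rfl fun x hx => by rw [(Finset.mem_filter.1 hx).2]
  obtain ⟨b, rfl⟩ := AddChar.exists_eq_mulShift hψ ψ₂
  have e3 : ∀ t : Eˣ, ∑ s : E, G (s, t) = if (t : E) = -b then χ t * Fintype.card E else 0 := by
    intro t
    have h1 : ∀ s : E, G (s, t) = χ t * ψ₁.mulShift (1 + b * (t : E)⁻¹) s := fun s => by
      simp only [G, AddChar.mulShift_apply, ← AddChar.map_add_eq_mul]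
      ring_nf
    simp only [h1, ← Finset.mul_sum]
    rw [AddChar.sum_eq_ite]
    have h2 : ψ₁.mulShift (1 + b * (t : E)⁻¹) = 0 ↔ (t : E) = -b := by
      have h3 : ψ₁.mulShift (1 + b * (t : E)⁻¹) = 0 ↔ 1 + b * (t : E)⁻¹ = 0 := by
        rw [← (AddChar.mulShift_injective_of_ne_one hψ).eq_iff, AddChar.mulShift_zero]
        rfl
      rw [h3]
      have := t.ne_zero
      field_simp
      rw [mul_zero, eq_neg_iff_add_eq_zero]
    simp only [h2, mul_ite, mul_zero]
  have e4 : kloostermanSum χ ψ₁ (ψ₁.mulShift b) ^ 2 +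
      kloostermanSum (χ.normLift L) (ψ₁.traceLift L) ((ψ₁.mulShift b).traceLift L) =
      2 * ∑ t : Eˣ, if (t : E) = -b then χ t * Fintype.card E else 0 := by
    rw [e1, e2, ← Finset.sum_add_distrib, Finset.sum_congr rfl fun t _ => (e3 t).symm,
      ← Fintype.sum_prod_type_right', Finset.mul_sum]
    refine Finset.sum_congr rfl fun w _ => ?_
    rw [← add_mul, ← Nat.cast_add, card_sumProd_add_card_traceNorm h2]
    simp
  rw [e4, norm_mul, Complex.norm_ofNat]
  gcongr
  by_cases hb : b = 0
  · simp [hb]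
  · rw [Finset.sum_eq_single (-Units.mk0 b hb)]
    · simp [norm_unitsHom_apply]
    · intro t _ ht
      rw [if_neg]
      exact fun h => ht (Units.ext (by simpa using h))
    · simp

end Quadratic

theorem AddChar.traceLift_ne_one {F L : Type} [Field F] [Field L] [Finite L] [Algebra F L]
    {ψ : AddChar F ℂ} (hψ : ψ ≠ 1) : ψ.traceLift L ≠ 1 := by
  obtain ⟨a, ha⟩ := AddChar.ne_one_iff.1 hψ
  obtain ⟨x, rfl⟩ := Algebra.trace_surjective F L a
  exact AddChar.ne_one_iff.2 ⟨x, ha⟩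

section Tower

variable {F : Type} [Field F] [Fintype F]

open Classical in
theorem exists_extension_norm_kloostermanSum_ge (χ : Fˣ →* ℂ) {ψ₁ : AddChar F ℂ} (hψ : ψ₁ ≠ 1)
    (ψ₂ : AddChar F ℂ) {δ : ℝ} (hδ : 0 ≤ δ)
    (h : (2 + δ) * √(Fintype.card F) ≤ ‖kloostermanSum χ ψ₁ ψ₂‖) (j : ℕ) :
    ∃ (E : Type) (_ : Field E) (_ : Fintype E) (_ : Algebra F E),
      Fintype.card E = Fintype.card F ^ 2 ^ j ∧ (2 + 4 ^ j * δ) * √(Fintype.card E) ≤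
        ‖kloostermanSum (χ.normLift E) (ψ₁.traceLift E) (ψ₂.traceLift E)‖ := by
  induction j with
  | zero =>
    refine ⟨F, inferInstance, inferInstance, inferInstance, by simp, ?_⟩
    convert h using 3
    · simp
    · ext x
      simp only [MonoidHom.normLift_apply]
      congr 1
      ext
      simp
    · ext x; simp
    · ext x; simp
  | succ j ih =>
    obtain ⟨E, _, _, _, hE, hK⟩ := ih
    obtain ⟨p, hp⟩ := CharP.exists E
    have : Fact p.Prime := ⟨CharP.char_is_prime E p⟩
    let L := FiniteField.Extension E p 2
    let _ : Fintype L := Fintype.ofFinite L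
    let _ : Algebra F L := ((algebraMap E L).comp (algebraMap F E)).toAlgebra
    have : IsScalarTower F E L := IsScalarTower.of_algebraMap_eq fun _ => rfl
    have h2 : Module.finrank E L = 2 := FiniteField.finrank_extension E p 2
    have hcard : Fintype.card L = Fintype.card E ^ 2 := by
      rw [Module.card_eq_pow_finrank (K := E), h2]
    refine ⟨L, inferInstance, inferInstance, inferInstance, by
      rw [hcard, hE, ← pow_mul, pow_succ], ?_⟩
    have key := norm_sq_kloostermanSum_add_le (L := L) h2 (χ.normLift E)
      (AddChar.traceLift_ne_one (L := E) hψ) (ψ₂.traceLift E)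
    have eχ : (χ.normLift E).normLift L = χ.normLift L := by
      ext x
      simp only [MonoidHom.normLift_apply]
      congr 1
      ext
      simp [Algebra.norm_norm]
    have eψ : ∀ ψ : AddChar F ℂ, (ψ.traceLift E).traceLift L = ψ.traceLift L := fun ψ => by
      ext x
      simp [Algebra.trace_trace]
    rw [eχ, eψ, eψ] at key
    set A := kloostermanSum (χ.normLift E) (ψ₁.traceLift E) (ψ₂.traceLift E)
    set B := kloostermanSum (χ.normLift L) (ψ₁.traceLift L) (ψ₂.traceLift L)
    have h3 : ‖A‖ ^ 2 ≤ 2 * Fintype.card E + ‖B‖ := by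
      rw [← norm_pow]
      calc ‖A ^ 2‖ = ‖(A ^ 2 + B) - B‖ := by ring_nf
        _ ≤ ‖A ^ 2 + B‖ + ‖B‖ := norm_sub_le _ _
        _ ≤ _ := by gcongr
    have h4 : ((2 + 4 ^ j * δ) * √(Fintype.card E)) ^ 2 ≤ ‖A‖ ^ 2 := by gcongr
    rw [mul_pow, Real.sq_sqrt (Nat.cast_nonneg _)] at h4
    have h5 : √(Fintype.card L : ℝ) = Fintype.card E := by
      rw [hcard, Nat.cast_pow, Real.sqrt_sq (Nat.cast_nonneg _)]
    rw [h5]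
    have h6 : (0 : ℝ) ≤ 4 ^ j * δ := by positivity
    have h7 : (0 : ℝ) ≤ Fintype.card E := Nat.cast_nonneg _
    have h8 := mul_nonneg (mul_nonneg h6 h6) h7
    rw [pow_succ]
    nlinarith

open Classical in
theorem norm_kloostermanSum_le_of_ne_one_left (χ : Fˣ →* ℂ) {ψ₁ : AddChar F ℂ} (hψ : ψ₁ ≠ 1)
    (ψ₂ : AddChar F ℂ) : ‖kloostermanSum χ ψ₁ ψ₂‖ ≤ 2 * √(Fintype.card F) := by
  by_contra! hlt
  set Q := Fintype.card F with hQ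
  have hQ2 : 2 ≤ Q := Fintype.one_lt_card
  have hQ0 : 0 < √(Q : ℝ) := Real.sqrt_pos.2 (by exact_mod_cast (by lia : 0 < Q))
  obtain ⟨δ, hδ, hKδ⟩ : ∃ δ > 0, (2 + δ) * √(Q : ℝ) ≤ ‖kloostermanSum χ ψ₁ ψ₂‖ := by
    refine ⟨‖kloostermanSum χ ψ₁ ψ₂‖ / √(Q : ℝ) - 2, ?_, ?_⟩
    · rw [gt_iff_lt, sub_pos, lt_div_iff₀ hQ0]; exact hlt
    · rw [add_sub_cancel, div_mul_cancel₀ _ hQ0.ne']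
  obtain ⟨b, rfl⟩ := AddChar.exists_eq_mulShift hψ ψ₂
  obtain ⟨j, hj1, hj2⟩ : ∃ j : ℕ, (2 * Q ^ 2) ^ 2 + 3 * (2 * Q ^ 2) + 1 < j ∧
      (6 * (Q : ℝ) ^ 2) / δ < j := by
    obtain ⟨m, hm⟩ := exists_nat_gt ((6 * (Q : ℝ) ^ 2) / δ)
    refine ⟨max m ((2 * Q ^ 2) ^ 2 + 3 * (2 * Q ^ 2) + 2), ?_, hm.trans_le ?_⟩
    · exact lt_of_lt_of_le (Nat.lt_succ_self _) (le_max_right _ _)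
    · exact_mod_cast le_max_left _ _
  obtain ⟨E, _, _, _, hE, hK⟩ := exists_extension_norm_kloostermanSum_ge χ hψ _ hδ.le hKδ (j + 1)
  obtain ⟨p, hp⟩ := CharP.exists E
  have : Fact p.Prime := ⟨CharP.char_is_prime E p⟩
  have : CharP F p := (Algebra.charP_iff F E p).2 hp
  obtain ⟨m, -, hm⟩ := FiniteField.card F p
  set S := Q ^ 2 ^ j with hS
  have hjS : j < S := by
    calc j < 2 ^ j := Nat.lt_two_pow_self
      _ < 2 ^ 2 ^ j := Nat.lt_two_pow_self
      _ ≤ S := Nat.pow_le_pow_left hQ2 _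
  have hES : Fintype.card E = S ^ 2 := by rw [hE, hS, ← pow_mul, pow_succ]
  have hup := norm_kloostermanSum_lift_le (L := E) S p (m * 2 ^ j) (by rw [hS, hQ, hm, ← pow_mul])
    (by rw [Nat.card_eq_fintype_card, hES]) (hj1.trans hjS) χ hψ b
  rw [hES, Nat.cast_pow, Real.sqrt_sq (Nat.cast_nonneg _)] at hK
  have h1 : (1 : ℝ) ≤ S := by exact_mod_cast (by lia : 1 ≤ S)
  have h2 : (2 + 4 ^ (j + 1) * δ) * (S : ℝ) ≤ (6 * Q ^ 2 + 2) * S := by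
    refine hK.trans (hup.trans ?_)
    have : (0 : ℝ) ≤ 2 * Q ^ 2 + 1 := by positivity
    nlinarith
  have h3 := le_of_mul_le_mul_right h2 (by linarith)
  have h4 : (j : ℝ) ≤ 4 ^ (j + 1) := by
    have : j < 4 ^ (j + 1) := (Nat.lt_succ_self j).trans (Nat.lt_pow_self (by lia))
    exact_mod_cast this.le
  rw [div_lt_iff₀ hδ] at hj2
  nlinarith

theorem kloostermanSum_inv {F : Type} [Field F] [Fintype Fˣ] (χ : Fˣ →* ℂ) (ψ₁ ψ₂ : AddChar F ℂ) :
    kloostermanSum χ ψ₁ ψ₂ = kloostermanSum (χ.comp invMonoidHom) ψ₂ ψ₁ := by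
  refine Fintype.sum_equiv (Equiv.inv Fˣ) _ _ fun x => ?_
  simp [mul_comm]

/-- **Weil's bound for Kloosterman sums** twisted by a multiplicative character. -/
theorem norm_kloostermanSum_le [Fintype Fˣ] (χ : Fˣ →* ℂ) {ψ₁ ψ₂ : AddChar F ℂ}
    (hψ : ψ₁ ≠ 1 ∨ ψ₂ ≠ 1) : ‖kloostermanSum χ ψ₁ ψ₂‖ ≤ 2 * √(Fintype.card F) := by
  rcases hψ with hψ | hψ
  · convert norm_kloostermanSum_le_of_ne_one_left χ hψ ψ₂
  · rw [kloostermanSum_inv]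
    convert norm_kloostermanSum_le_of_ne_one_left (χ.comp invMonoidHom) hψ ψ₁

end Tower

/-- A combinatorial sieve: if the sizes of all intersections of the sets of elements satisfying
`bad i` are approximately multiplicative, then some element satisfies none of the conditions. -/
theorem Finset.exists_mem_forall_not_of_sieve {α ι : Type*} (U : Finset α) (I : Finset ι)
    (bad : ι → α → Prop) [∀ i, DecidablePred (bad i)] (δ : ι → ℝ) (X ε : ℝ)
    (hδ : ∀ i ∈ I, δ i ≤ 1 / 2) (hX : 4 ^ I.card * ε < X)
    (hcount : ∀ J ⊆ I, |((U.filter fun x => ∀ i ∈ J, bad i x).card : ℝ) - X * ∏ i ∈ J, δ i| ≤ ε) :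
    ∃ x ∈ U, ∀ i ∈ I, ¬ bad i x := by
  classical
  by_contra! hbad
  have hε : 0 ≤ ε := (abs_nonneg _).trans (hcount ∅ (Finset.empty_subset I))
  have hX0 : 0 ≤ X := le_trans (by positivity) hX.le
  have h1 : ∑ J ∈ I.powerset, (-1 : ℝ) ^ J.card * (U.filter fun x => ∀ i ∈ J, bad i x).card = 0 := by
    have h2 : ∀ x ∈ U, ∏ i ∈ I, (1 + -(if bad i x then (1 : ℝ) else 0)) = 0 := fun x hx => by
      obtain ⟨i, hi, hb⟩ := hbad x hx
      exact Finset.prod_eq_zero hi (by simp [hb])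
    rw [← Finset.sum_eq_zero h2]
    simp only [Finset.prod_one_add]
    rw [Finset.sum_comm]
    refine Finset.sum_congr rfl fun J _ => ?_
    simp only [Finset.prod_neg, Finset.prod_boole]
    rw [← Finset.mul_sum, Finset.sum_boole]
  have h3 : X * ∏ i ∈ I, (1 + -δ i) = ∑ J ∈ I.powerset, (-1 : ℝ) ^ J.card * (X * ∏ i ∈ J, δ i) := by
    rw [Finset.prod_one_add, Finset.mul_sum]
    refine Finset.sum_congr rfl fun J _ => ?_
    rw [Finset.prod_neg]
    ring
  have h4 : |X * ∏ i ∈ I, (1 + -δ i)| ≤ 2 ^ I.card * ε := by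
    have hcard : (2 : ℝ) ^ I.card * ε = ∑ _J ∈ I.powerset, ε := by
      rw [Finset.sum_const, Finset.card_powerset, nsmul_eq_mul]
      push_cast
      rfl
    rw [← sub_zero (X * _), h3, ← h1, ← Finset.sum_sub_distrib, hcard]
    refine (Finset.abs_sum_le_sum_abs _ _).trans (Finset.sum_le_sum fun J hJ => ?_)
    rw [← mul_sub, abs_mul, abs_pow, abs_neg, abs_one, one_pow, one_mul, abs_sub_comm]
    exact hcount J (Finset.mem_powerset.1 hJ)
  have h5 : (1 / 2 : ℝ) ^ I.card ≤ ∏ i ∈ I, (1 + -δ i) := by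
    rw [← Finset.prod_const]
    exact Finset.prod_le_prod (fun _ _ => by norm_num) fun i hi => by linarith [hδ i hi]
  have h6 : X * (1 / 2) ^ I.card ≤ 2 ^ I.card * ε :=
    (mul_le_mul_of_nonneg_left h5 hX0).trans ((le_abs_self _).trans h4)
  have h7 : X * (1 / 2) ^ I.card * 2 ^ I.card = X := by
    rw [mul_assoc, ← mul_pow]; norm_num
  have h8 : (2 : ℝ) ^ I.card * ε * 2 ^ I.card = 4 ^ I.card * ε := by
    rw [mul_right_comm, ← mul_pow]; norm_num
  have h9 := mul_le_mul_of_nonneg_right h6 (by positivity : (0 : ℝ) ≤ 2 ^ I.card)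
  rw [h7, h8] at h9
  linarith

theorem AddSubgroup.sum_addChar_quotient {A : Type*} [AddCommGroup A] [Finite A]
    (W : AddSubgroup A) [Fintype (AddChar (A ⧸ W) ℂ)] (x : A) [Decidable (x ∈ W)] :
    ∑ ψ : AddChar (A ⧸ W) ℂ, ψ (QuotientAddGroup.mk' W x) = if x ∈ W then (W.index : ℂ) else 0 := by
  classical
  let _ := Fintype.ofFinite (A ⧸ W)
  have h := AddChar.sum_apply_eq_ite (QuotientAddGroup.mk' W x)
  simp only [QuotientAddGroup.mk'_apply, QuotientAddGroup.eq_zero_iff,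
    ← Nat.card_eq_fintype_card] at h
  simp only [QuotientAddGroup.mk'_apply, AddSubgroup.index]
  convert h

theorem AddSubgroup.finite_addChar_quotient {A : Type*} [AddCommGroup A] [Finite A]
    (W : AddSubgroup A) : Finite (AddChar (A ⧸ W) ℂ) := inferInstance

theorem AddSubgroup.card_addChar_quotient {A : Type*} [AddCommGroup A] [Finite A]
    (W : AddSubgroup A) : Nat.card (AddChar (A ⧸ W) ℂ) = W.index := by
  let _ := Fintype.ofFinite (A ⧸ W)
  rw [Nat.card_eq_fintype_card, AddChar.card_eq, AddSubgroup.index, Nat.card_eq_fintype_card]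

/-- A character of a quotient of a multiplicative group, written additively, as a character of the
group. -/
def quotientChar {G : Type*} [CommGroup G] (H : AddSubgroup (Additive G))
    (θ : AddChar (Additive G ⧸ H) ℂ) : G →* ℂ where
  toFun x := θ (QuotientAddGroup.mk' H (Additive.ofMul x))
  map_one' := by rw [ofMul_one, map_zero, AddChar.map_zero_eq_one]
  map_mul' x y := by rw [ofMul_mul, map_add, AddChar.map_add_eq_mul]

theorem quotientChar_apply {G : Type*} [CommGroup G] (H : AddSubgroup (Additive G))
    (θ : AddChar (Additive G ⧸ H) ℂ) (x : G) :
    quotientChar H θ x = θ (QuotientAddGroup.mk' H (Additive.ofMul x)) := rfl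

theorem quotientChar_ne_one {G : Type*} [CommGroup G] {H : AddSubgroup (Additive G)}
    {θ : AddChar (Additive G ⧸ H) ℂ} (hθ : θ ≠ 1) : ∃ x, quotientChar H θ x ≠ 1 := by
  obtain ⟨a, ha⟩ := AddChar.ne_one_iff.1 hθ
  obtain ⟨x, rfl⟩ := QuotientAddGroup.mk'_surjective H a
  exact ⟨x.toMul, ha⟩

theorem AddChar.comp_mk_ne_one {A : Type*} [AddCommGroup A] {W : AddSubgroup A}
    {ψ : AddChar (A ⧸ W) ℂ} (hψ : ψ ≠ 1) :
    ψ.compAddMonoidHom (QuotientAddGroup.mk' W) ≠ 1 := by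
  obtain ⟨a, ha⟩ := AddChar.ne_one_iff.1 hψ
  obtain ⟨x, rfl⟩ := QuotientAddGroup.mk'_surjective W a
  exact AddChar.ne_one_iff.2 ⟨x, ha⟩

theorem kloostermanSum_one_one_of_ne {F : Type} [Field F] [Fintype Fˣ] {χ : Fˣ →* ℂ} {a : Fˣ}
    (ha : χ a ≠ 1) : kloostermanSum χ 1 1 = 0 := by
  have h : χ a * kloostermanSum χ 1 1 = kloostermanSum χ 1 1 := by
    rw [kloostermanSum, Finset.mul_sum]
    refine Fintype.sum_equiv (Equiv.mulLeft a) _ _ fun x => ?_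
    simp
  exact (mul_left_eq_self₀.1 h).resolve_left ha

/-- Triples of characters that are trivial on given subgroups. -/
abbrev CharTriple {F : Type} [Field F] (W₁ W₂ : AddSubgroup F) (H : AddSubgroup (Additive Fˣ)) :
    Type :=
  AddChar (F ⧸ W₁) ℂ × AddChar (F ⧸ W₂) ℂ × AddChar (Additive Fˣ ⧸ H) ℂ

open Classical in
/-- Elements of a finite field with conditions on `x`, `x⁻¹` and on the multiplicative class
of `x` are equidistributed. -/
theorem abs_card_filter_sub_le {F : Type} [Field F] [Fintype F]
    (W₁ W₂ : AddSubgroup F) (H : AddSubgroup (Additive Fˣ)) :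
    |((Finset.univ.filter fun x : Fˣ =>
      (x : F) ∈ W₁ ∧ (x : F)⁻¹ ∈ W₂ ∧ Additive.ofMul x ∈ H).card : ℝ) -
      ((Fintype.card F : ℝ) - 1) / (W₁.index * W₂.index * H.index)| ≤ 2 * √(Fintype.card F) := by
  have : Finite (AddChar (Additive Fˣ ⧸ H) ℂ) := AddSubgroup.finite_addChar_quotient H
  let _ := Fintype.ofFinite (AddChar (Additive Fˣ ⧸ H) ℂ)
  set c := (Finset.univ.filter fun x : Fˣ =>
    (x : F) ∈ W₁ ∧ (x : F)⁻¹ ∈ W₂ ∧ Additive.ofMul x ∈ H).card with hc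
  let K : CharTriple W₁ W₂ H → ℂ := fun t => kloostermanSum (quotientChar H t.2.2)
    (t.1.compAddMonoidHom (QuotientAddGroup.mk' W₁))
    (t.2.1.compAddMonoidHom (QuotientAddGroup.mk' W₂))
  set m : ℕ := W₁.index * W₂.index * H.index with hm
  have hT : Fintype.card (CharTriple W₁ W₂ H) = m := by
    rw [← Nat.card_eq_fintype_card, Nat.card_prod, Nat.card_prod,
      AddSubgroup.card_addChar_quotient, AddSubgroup.card_addChar_quotient,
      AddSubgroup.card_addChar_quotient, hm, mul_assoc]
  have hm0 : (0 : ℝ) < m := by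
    rw [← hT]; exact_mod_cast Fintype.card_pos
  have hsum : ∑ t, K t = m * c := by
    have h1 : ∀ x : Fˣ, ∑ t : CharTriple W₁ W₂ H, quotientChar H t.2.2 x *
        (t.1 (QuotientAddGroup.mk' W₁ x) * t.2.1 (QuotientAddGroup.mk' W₂ (x : F)⁻¹)) =
        if (x : F) ∈ W₁ ∧ (x : F)⁻¹ ∈ W₂ ∧ Additive.ofMul x ∈ H then (m : ℂ) else 0 := fun x => by
      have : (if (x : F) ∈ W₁ ∧ (x : F)⁻¹ ∈ W₂ ∧ Additive.ofMul x ∈ H then (m : ℂ) else 0) =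
          (if (x : F) ∈ W₁ then (W₁.index : ℂ) else 0) *
          ((if (x : F)⁻¹ ∈ W₂ then (W₂.index : ℂ) else 0) *
          (if Additive.ofMul x ∈ H then (H.index : ℂ) else 0)) := by
        by_cases h1 : (x : F) ∈ W₁ <;> by_cases h2 : (x : F)⁻¹ ∈ W₂ <;>
          by_cases h3 : Additive.ofMul x ∈ H <;> simp [h1, h2, h3, hm, mul_assoc]
      rw [this, ← AddSubgroup.sum_addChar_quotient, ← AddSubgroup.sum_addChar_quotient,
        ← AddSubgroup.sum_addChar_quotient, Fintype.sum_mul_sum, Fintype.sum_mul_sum,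
        Fintype.sum_prod_type]
      refine Finset.sum_congr rfl fun ψ₁ _ => ?_
      rw [Fintype.sum_prod_type]
      refine Finset.sum_congr rfl fun ψ₂ _ => ?_
      rw [Finset.mul_sum]
      refine Finset.sum_congr rfl fun θ _ => ?_
      rw [quotientChar_apply]
      ring
    calc ∑ t, K t = ∑ x : Fˣ, ∑ t : CharTriple W₁ W₂ H, quotientChar H t.2.2 x *
          (t.1 (QuotientAddGroup.mk' W₁ x) * t.2.1 (QuotientAddGroup.mk' W₂ (x : F)⁻¹)) := by
          rw [Finset.sum_comm]
          refine Finset.sum_congr rfl fun t _ => Finset.sum_congr rfl fun x _ => ?_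
          simp
      _ = m * c := by
          simp only [h1]
          rw [← Finset.sum_filter, Finset.sum_const, nsmul_eq_mul, mul_comm]
  have hK : ∀ t, ‖K t - if t = 1 then ((Fintype.card F : ℂ) - 1) else 0‖ ≤
      2 * √(Fintype.card F) := by
    intro t
    by_cases ht : t = 1
    · have h1 : K t = (Fintype.card F : ℂ) - 1 := by
        have : Fintype.card Fˣ = Fintype.card F - 1 := Fintype.card_units F
        subst ht
        simp only [K, kloostermanSum, quotientChar_apply, AddChar.compAddMonoidHom_apply,
          Prod.fst_one, Prod.snd_one, AddChar.one_apply, mul_one, Finset.sum_const,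
          Finset.card_univ, nsmul_eq_mul, this]
        rw [Nat.cast_sub Fintype.card_pos, Nat.cast_one]
      rw [if_pos ht, h1, sub_self, norm_zero]
      positivity
    · rw [if_neg ht, sub_zero]
      by_cases h1 : t.1 = 1
      · by_cases h2 : t.2.1 = 1
        · have h3 : t.2.2 ≠ 1 := fun h3 => ht (Prod.ext h1 (Prod.ext h2 h3))
          obtain ⟨x, hx⟩ := quotientChar_ne_one h3
          have : K t = 0 := by
            simp only [K, h1, h2]
            exact kloostermanSum_one_one_of_ne hx
          rw [this, norm_zero]
          positivity
        · exact norm_kloostermanSum_le _ (Or.inr (AddChar.comp_mk_ne_one h2))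
      · exact norm_kloostermanSum_le _ (Or.inl (AddChar.comp_mk_ne_one h1))
  have hfin : ‖(m : ℂ) * c - ((Fintype.card F : ℂ) - 1)‖ ≤ m * (2 * √(Fintype.card F)) := by
    calc ‖(m : ℂ) * c - ((Fintype.card F : ℂ) - 1)‖ =
        ‖∑ t, (K t - if t = 1 then ((Fintype.card F : ℂ) - 1) else 0)‖ := by
          rw [Finset.sum_sub_distrib, hsum, Finset.sum_ite_eq' Finset.univ 1]
          simp
      _ ≤ ∑ _t : CharTriple W₁ W₂ H, 2 * √(Fintype.card F) :=
          norm_sum_le_of_le _ fun t _ => hK t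
      _ = m * (2 * √(Fintype.card F)) := by
          rw [Finset.sum_const, Finset.card_univ, hT, nsmul_eq_mul]
  have hreal : |(m : ℝ) * c - ((Fintype.card F : ℝ) - 1)| ≤ m * (2 * √(Fintype.card F)) := by
    rw [← Real.norm_eq_abs, ← Complex.norm_real]
    push_cast
    exact hfin
  have hdiv : (c : ℝ) - ((Fintype.card F : ℝ) - 1) / m =
      (m * c - ((Fintype.card F : ℝ) - 1)) / m := by
    field_simp
  have hmc : ((W₁.index : ℝ) * W₂.index * H.index) = m := by rw [hm]; push_cast; rfl
  rw [hmc, hdiv, abs_div, abs_of_pos hm0, div_le_iff₀ hm0, mul_comm _ (m : ℝ)]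
  exact hreal

theorem prod_mul_dvd_iff_forall_mul_dvd {R : Type*} [CommMonoidWithZero R] [IsCancelMulZero R]
    [DecompositionMonoid R] {s : Finset R} (hs : (s : Set R).Pairwise IsRelPrime) {d h : R}
    (hh : h ≠ 0) (hd : d ∣ h) : (∏ p ∈ s, p) * d ∣ h ↔ ∀ p ∈ s, p * d ∣ h := by
  obtain ⟨c, rfl⟩ := hd
  have hd0 : d ≠ 0 := left_ne_zero_of_mul hh
  simp only [mul_comm _ d, mul_dvd_mul_iff_left hd0]
  exact ⟨fun h p hp => (Finset.dvd_prod_of_mem _ hp).trans h,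
    fun h => Finset.prod_dvd_of_isRelPrime hs h⟩

theorem Polynomial.dvd_div_iff_mul_dvd {K : Type*} [Field K] {d h p : K[X]} (hp : p ≠ 0)
    (hph : p ∣ h) : d ∣ h / p ↔ p * d ∣ h := by
  obtain ⟨c, rfl⟩ := hph
  rw [mul_div_cancel_left₀ c hp, mul_dvd_mul_iff_left hp]

section Frobenius

variable (Fq : Type) {F : Type} [Field Fq] [Fintype Fq] [Field F] [Algebra Fq F]

variable (F) in
/-- The kernel of `g` applied to the Frobenius endomorphism. -/
def frobeniusKer {Fq : Type} [Field Fq] [Fintype Fq] [Algebra Fq F] (g : Fq[X]) : Submodule Fq F :=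
  LinearMap.ker (aeval (FiniteField.frobeniusAlgHom Fq F).toLinearMap g)

variable {Fq}

theorem aeval_frobeniusAlgHom_apply (g : Fq[X]) (β : F) :
    aeval (FiniteField.frobeniusAlgHom Fq F).toLinearMap g β = polyAct (Fintype.card Fq) g β := by
  rw [aeval_def, eval₂_eq_sum, polyAct, Polynomial.sum, Polynomial.sum, LinearMap.sum_apply]
  refine Finset.sum_congr rfl fun i _ => ?_
  rw [Module.End.mul_apply, Module.algebraMap_end_apply, Algebra.smul_def, Module.End.pow_apply]
  congr 1
  change (FiniteField.frobeniusAlgHom Fq F)^[i] β = _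
  rw [FiniteField.coe_frobeniusAlgHom, pow_iterate]

theorem mem_frobeniusKer {g : Fq[X]} {β : F} :
    β ∈ frobeniusKer F g ↔ polyAct (Fintype.card Fq) g β = 0 := by
  rw [frobeniusKer, LinearMap.mem_ker, aeval_frobeniusAlgHom_apply]

theorem exists_mem_frobeniusKer_iff_dvd (β : F) :
    ∃ d : Fq[X], ∀ g, β ∈ frobeniusKer F g ↔ d ∣ g := by
  let I : Ideal Fq[X] :=
    { carrier := {g | β ∈ frobeniusKer F g}
      add_mem' := fun {a b} ha hb => by
        simp only [Set.mem_ofPred_eq, frobeniusKer, LinearMap.mem_ker] at ha hb ⊢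
        rw [map_add, LinearMap.add_apply, ha, hb, add_zero]
      zero_mem' := by simp [frobeniusKer]
      smul_mem' := fun c a ha => by
        simp only [Set.mem_ofPred_eq, frobeniusKer, LinearMap.mem_ker] at ha ⊢
        rw [smul_eq_mul, map_mul, Module.End.mul_apply, ha, map_zero] }
  obtain ⟨d, hd⟩ := IsPrincipalIdealRing.principal I
  refine ⟨d, fun g => ?_⟩
  rw [← Ideal.mem_span_singleton, ← Ideal.submodule_span_eq, ← hd]
  rfl

theorem mem_frobeniusKer_div_prod_iff {h : Fq[X]} (hh : h ≠ 0) {s : Finset Fq[X]}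
    (hs : (s : Set Fq[X]).Pairwise IsRelPrime) (hsh : ∀ p ∈ s, p ∣ h) (β : F) :
    β ∈ frobeniusKer F (h / ∏ p ∈ s, p) ↔
      β ∈ frobeniusKer F h ∧ ∀ p ∈ s, β ∈ frobeniusKer F (h / p) := by
  obtain ⟨d, hd⟩ := exists_mem_frobeniusKer_iff_dvd (Fq := Fq) β
  have hprod : ∏ p ∈ s, p ∣ h := Finset.prod_dvd_of_isRelPrime hs hsh
  simp only [hd]
  rw [dvd_div_iff_mul_dvd (ne_zero_of_dvd_ne_zero hh hprod) hprod]
  refine ⟨fun H => ?_, fun H => ?_⟩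
  · have hdh := (Dvd.intro_left _ rfl).trans H
    refine ⟨hdh, fun p hp => ?_⟩
    rw [dvd_div_iff_mul_dvd (ne_zero_of_dvd_ne_zero hh (hsh p hp)) (hsh p hp)]
    exact (prod_mul_dvd_iff_forall_mul_dvd hs hh hdh).1 H p hp
  · refine (prod_mul_dvd_iff_forall_mul_dvd hs hh H.1).2 fun p hp => ?_
    rw [← dvd_div_iff_mul_dvd (ne_zero_of_dvd_ne_zero hh (hsh p hp)) (hsh p hp)]
    exact H.2 p hp

theorem isFqOrder_of_forall_notMem {n : ℕ} {h : Fq[X]} (hm : h.Monic) (hn : h ∣ X ^ n - 1) {β : F}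
    (hβ : β ∈ frobeniusKer F h)
    (hp : ∀ p : Fq[X], p.Monic → Irreducible p → p ∣ h → β ∉ frobeniusKer F (h / p)) :
    IsFqOrder (Fintype.card Fq) n h β := by
  refine ⟨hm, hn, mem_frobeniusKer.1 hβ, fun h' hm' _ hβ' => ?_⟩
  obtain ⟨d, hd⟩ := exists_mem_frobeniusKer_iff_dvd (Fq := Fq) β
  rw [← mem_frobeniusKer, hd] at hβ'
  obtain ⟨c, hc⟩ := (hd h).1 hβ
  have hc0 : c ≠ 0 := right_ne_zero_of_mul (hc ▸ hm.ne_zero)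
  have hcu : IsUnit c := by
    by_contra hcu
    obtain ⟨p, hpm, hpi, hpc⟩ := exists_monic_irreducible_factor c hcu
    have hph : p ∣ h := hc ▸ hpc.mul_left d
    refine hp p hpm hpi hph ?_
    rw [hd, dvd_div_iff_mul_dvd hpi.ne_zero hph, hc, mul_comm p]
    exact mul_dvd_mul_left d hpc
  refine natDegree_le_of_dvd ?_ hm'.ne_zero
  rw [hc]
  exact (hcu.mul_right_dvd).2 hβ'

variable [Fintype F]

theorem aeval_frobeniusAlgHom_X_pow_sub_one :
    aeval (FiniteField.frobeniusAlgHom Fq F).toLinearMap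
      (X ^ Module.finrank Fq F - 1 : Fq[X]) = 0 := by
  rw [← FiniteField.minpoly_frobeniusAlgHom]
  exact minpoly.aeval _ _

theorem card_frobeniusKer_le {g : Fq[X]} (hg : g ≠ 0) :
    Nat.card (frobeniusKer F g) ≤ Fintype.card Fq ^ g.natDegree := by
  classical
  have hq : 1 < Fintype.card Fq := Fintype.one_lt_card
  let L : F[X] := g.sum fun i a => C (algebraMap Fq F a) * X ^ Fintype.card Fq ^ i
  have heval : ∀ β, L.eval β = polyAct (Fintype.card Fq) g β := fun β => by
    simp [L, polyAct, Polynomial.sum, eval_finsetSum]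
  have hcoeff : L.coeff (Fintype.card Fq ^ g.natDegree) ≠ 0 := by
    simp only [L, Polynomial.sum, finsetSum_coeff, coeff_C_mul_X_pow, Nat.pow_right_inj hq]
    simpa using hg
  have hL : L ≠ 0 := fun h => hcoeff (by rw [h, coeff_zero])
  have hdeg : L.natDegree ≤ Fintype.card Fq ^ g.natDegree :=
    natDegree_sum_le_of_forall_le _ _ fun i hi => (natDegree_C_mul_X_pow_le _ _).trans
      (Nat.pow_le_pow_right hq.le (le_natDegree_of_mem_supp i hi))
  calc Nat.card (frobeniusKer F g) = (Finset.univ.filter (· ∈ frobeniusKer F g)).card := by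
        rw [Nat.card_eq_fintype_card, Fintype.card_subtype]
    _ ≤ L.roots.toFinset.card := Finset.card_le_card fun β hβ => by
        rw [Multiset.mem_toFinset, mem_roots hL, IsRoot, heval, ← mem_frobeniusKer]
        exact (Finset.mem_filter.1 hβ).2
    _ ≤ L.natDegree := (Multiset.toFinset_card_le _).trans (card_roots' L)
    _ ≤ _ := hdeg

theorem finrank_frobeniusKer {g : Fq[X]} (hg : g ∣ X ^ Module.finrank Fq F - 1) :
    Module.finrank Fq (frobeniusKer F g) = g.natDegree := by
  have hn : 0 < Module.finrank Fq F := Module.finrank_pos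
  have hle : ∀ g : Fq[X], g ≠ 0 → Module.finrank Fq (frobeniusKer F g) ≤ g.natDegree := by
    intro g hg
    have h := card_frobeniusKer_le (F := F) hg
    rw [Module.natCard_eq_pow_finrank (K := Fq), Nat.card_eq_fintype_card] at h
    exact (Nat.pow_le_pow_iff_right Fintype.one_lt_card).1 h
  obtain ⟨g', hg'⟩ := hg
  have h0 : (X ^ Module.finrank Fq F - 1 : Fq[X]) ≠ 0 := X_pow_sub_C_ne_zero hn 1
  have hg0 : g ≠ 0 := left_ne_zero_of_mul (hg' ▸ h0)
  have hg0' : g' ≠ 0 := right_ne_zero_of_mul (hg' ▸ h0)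
  have hdeg : Module.finrank Fq F = g.natDegree + g'.natDegree := by
    rw [← natDegree_mul hg0 hg0', ← hg', ← C_1, natDegree_X_pow_sub_C]
  have hrange : LinearMap.range (aeval (FiniteField.frobeniusAlgHom Fq F).toLinearMap g') ≤
      frobeniusKer F g := by
    rw [frobeniusKer, LinearMap.range_le_ker_iff, ← Module.End.mul_eq_comp, ← map_mul, ← hg',
      aeval_frobeniusAlgHom_X_pow_sub_one]
  have h1 := LinearMap.finrank_range_add_finrank_ker
    (aeval (FiniteField.frobeniusAlgHom Fq F).toLinearMap g')
  have h2 := Submodule.finrank_mono hrange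
  have h3 := hle g hg0
  have h4 := hle g' hg0'
  rw [frobeniusKer] at h4
  omega

theorem index_frobeniusKer {g g' : Fq[X]} (hg : g * g' = X ^ Module.finrank Fq F - 1) :
    (frobeniusKer F g).toAddSubgroup.index = Fintype.card Fq ^ g'.natDegree := by
  have hn : 0 < Module.finrank Fq F := Module.finrank_pos
  have h0 : (X ^ Module.finrank Fq F - 1 : Fq[X]) ≠ 0 := X_pow_sub_C_ne_zero hn 1
  have hdeg : Module.finrank Fq F = g.natDegree + g'.natDegree := by
    rw [← natDegree_mul (left_ne_zero_of_mul (hg ▸ h0)) (right_ne_zero_of_mul (hg ▸ h0)), hg,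
      ← C_1, natDegree_X_pow_sub_C]
  have h := (frobeniusKer F g).toAddSubgroup.card_mul_index
  have hcard : Nat.card (frobeniusKer F g).toAddSubgroup = Fintype.card Fq ^ g.natDegree := by
    rw [← finrank_frobeniusKer (F := F) (Dvd.intro _ hg), ← Nat.card_eq_fintype_card]
    exact Module.natCard_eq_pow_finrank (K := Fq) (V := frobeniusKer F g)
  rw [hcard, Module.natCard_eq_pow_finrank (K := Fq) (V := F), hdeg, pow_add,
    Nat.card_eq_fintype_card] at h
  exact Nat.eq_of_mul_eq_mul_left (pow_pos Fintype.card_pos _) h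

end Frobenius

theorem Polynomial.mem_primeFactors_iff {K : Type*} [Field K] [DecidableEq K] {p h : K[X]}
    (hh : h ≠ 0) : p ∈ UniqueFactorizationMonoid.primeFactors h ↔
      p.Monic ∧ Irreducible p ∧ p ∣ h := by
  rw [UniqueFactorizationMonoid.mem_primeFactors,
    UniqueFactorizationMonoid.mem_normalizedFactors_iff' hh]
  refine ⟨fun ⟨hi, hn, hd⟩ => ⟨hn ▸ monic_normalize hi.ne_zero, hi, hd⟩,
    fun ⟨hm, hi, hd⟩ => ⟨hi, hm.normalize_eq_self, hd⟩⟩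

theorem pow_div_prod_eq_one_iff {G : Type*} [Group G] {M : ℕ} (hM : M ≠ 0) {s : Finset ℕ}
    (hs : s ⊆ M.primeFactors) (x : G) :
    x ^ (M / ∏ l ∈ s, l) = 1 ↔ x ^ M = 1 ∧ ∀ l ∈ s, x ^ (M / l) = 1 := by
  have hrel : (s : Set ℕ).Pairwise IsRelPrime := fun l hl l' hl' hne => by
    rw [← Nat.coprime_iff_isRelPrime]
    exact (Nat.coprime_primes (Nat.prime_of_mem_primeFactors (hs hl))
      (Nat.prime_of_mem_primeFactors (hs hl'))).2 hne
  have hdvd : ∀ l ∈ s, l ∣ M := fun l hl => Nat.dvd_of_mem_primeFactors (hs hl)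
  have hprod : ∏ l ∈ s, l ∣ M := Finset.prod_dvd_of_isRelPrime hrel hdvd
  simp only [← orderOf_dvd_iff_pow_eq_one]
  rw [Nat.dvd_div_iff_mul_dvd hprod]
  refine ⟨fun H => ?_, fun H => ?_⟩
  · have hd := (Dvd.intro_left _ rfl).trans H
    refine ⟨hd, fun l hl => (Nat.dvd_div_iff_mul_dvd (hdvd l hl)).2 ?_⟩
    exact (prod_mul_dvd_iff_forall_mul_dvd hrel hM hd).1 H l hl
  · exact (prod_mul_dvd_iff_forall_mul_dvd hrel hM H.1).2 fun l hl =>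
      (Nat.dvd_div_iff_mul_dvd (hdvd l hl)).1 (H.2 l hl)

theorem index_ker_powMonoidHom_units {F : Type*} [Field F] [Fintype F] {a b : ℕ}
    (h : a * b = Fintype.card F - 1) : (powMonoidHom a : Fˣ →* Fˣ).ker.index = b := by
  classical
  have hpos : 0 < a * b := by
    have := Fintype.one_lt_card (α := F)
    omega
  rw [IsCyclic.index_powMonoidHom_ker, Nat.card_eq_fintype_card, Fintype.card_units, ← h,
    Nat.gcd_mul_right_left, Nat.mul_div_cancel_left _ (Nat.pos_of_mul_pos_right hpos)]

theorem index_frobeniusKer_div_prod {Fq F : Type} [Field Fq] [Fintype Fq] [Field F] [Fintype F]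
    [Algebra Fq F] {h g : Fq[X]} (hg : h * g = X ^ Module.finrank Fq F - 1) {s : Finset Fq[X]}
    (hs : (s : Set Fq[X]).Pairwise IsRelPrime) (hsh : ∀ p ∈ s, p ∣ h) :
    (frobeniusKer F (h / ∏ p ∈ s, p)).toAddSubgroup.index =
      Fintype.card Fq ^ g.natDegree * ∏ p ∈ s, Fintype.card Fq ^ p.natDegree := by
  have h0 : (X ^ Module.finrank Fq F - 1 : Fq[X]) ≠ 0 := X_pow_sub_C_ne_zero Module.finrank_pos 1
  have hh0 : h ≠ 0 := left_ne_zero_of_mul (hg ▸ h0)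
  have hg0 : g ≠ 0 := right_ne_zero_of_mul (hg ▸ h0)
  have hp0 : ∀ p ∈ s, p ≠ 0 := fun p hp => ne_zero_of_dvd_ne_zero hh0 (hsh p hp)
  have hprod : ∏ p ∈ s, p ∣ h := Finset.prod_dvd_of_isRelPrime hs hsh
  have hdiv : h / (∏ p ∈ s, p) * (∏ p ∈ s, p) = h := by
    rw [mul_comm, EuclideanDomain.mul_div_cancel' (Finset.prod_ne_zero_iff.2 hp0) hprod]
  rw [index_frobeniusKer (g' := (∏ p ∈ s, p) * g) (by rw [← mul_assoc, hdiv, hg]),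
    natDegree_mul (Finset.prod_ne_zero_iff.2 hp0) hg0, natDegree_prod _ _ hp0, add_comm, pow_add,
    Finset.prod_pow_eq_pow_sum]

open Classical in
theorem exists_orderOf_eq_and_isFqOrder {Fq F : Type} [Field Fq] [Fintype Fq]
    [Field F] [Fintype F] [Algebra Fq F] {h g : Fq[X]} (hm : h.Monic)
    (hg : h * g = X ^ Module.finrank Fq F - 1) {M r : ℕ} (hMr : M * r = Fintype.card F - 1)
    (hlt : 4 ^ (2 * (UniqueFactorizationMonoid.primeFactors h).card + M.primeFactors.card) *
      (2 * √(Fintype.card F)) <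
        ((Fintype.card F : ℝ) - 1) / (r * (Fintype.card Fq : ℝ) ^ (2 * g.natDegree))) :
    ∃ x : Fˣ, orderOf x = M ∧
      IsFqOrder (Fintype.card Fq) (Module.finrank Fq F) h (x : F) ∧
      IsFqOrder (Fintype.card Fq) (Module.finrank Fq F) h (x : F)⁻¹ := by
  have hM : M ≠ 0 := by
    rintro rfl
    have := Fintype.one_lt_card (α := F)
    omega
  have hq : (2 : ℝ) ≤ Fintype.card Fq := by exact_mod_cast Fintype.one_lt_card (α := Fq)
  set A := UniqueFactorizationMonoid.primeFactors h
  set B := M.primeFactors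
  have hAmem : ∀ p ∈ A, p.Monic ∧ Irreducible p ∧ p ∣ h := fun p hp =>
    (mem_primeFactors_iff hm.ne_zero).1 hp
  have hArel : ∀ s ⊆ A, (s : Set Fq[X]).Pairwise IsRelPrime := fun s hs =>
    UniqueFactorizationMonoid.pairwise_primeFactors_isRelPrime.mono (by exact_mod_cast hs)
  let U : Finset Fˣ := Finset.univ.filter fun x =>
    (x : F) ∈ frobeniusKer F h ∧ (x : F)⁻¹ ∈ frobeniusKer F h ∧ x ^ M = 1
  let bad : Fq[X] ⊕ Fq[X] ⊕ ℕ → Fˣ → Prop :=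
    Sum.elim (fun p x => (x : F) ∈ frobeniusKer F (h / p))
      (Sum.elim (fun p x => (x : F)⁻¹ ∈ frobeniusKer F (h / p)) fun l x => x ^ (M / l) = 1)
  let δ : Fq[X] ⊕ Fq[X] ⊕ ℕ → ℝ :=
    Sum.elim (fun p => ((Fintype.card Fq : ℝ) ^ p.natDegree)⁻¹)
      (Sum.elim (fun p => ((Fintype.card Fq : ℝ) ^ p.natDegree)⁻¹) fun l => (l : ℝ)⁻¹)
  have hδA : ∀ p ∈ A, ((Fintype.card Fq : ℝ) ^ p.natDegree)⁻¹ ≤ 1 / 2 := fun p hp => by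
    rw [one_div]
    refine inv_anti₀ two_pos (hq.trans (le_self_pow₀ (by linarith) ?_))
    exact (hAmem p hp).2.1.natDegree_pos.ne'
  have hsieve : ∃ x ∈ U, ∀ i ∈ A.disjSum (A.disjSum B), ¬ bad i x := by
    refine Finset.exists_mem_forall_not_of_sieve U (A.disjSum (A.disjSum B)) bad δ
      (((Fintype.card F : ℝ) - 1) / (r * (Fintype.card Fq : ℝ) ^ (2 * g.natDegree)))
      (2 * √(Fintype.card F)) ?_ ?_ ?_
    · simp only [Finset.mem_disjSum]
      rintro _ (⟨p, hp, rfl⟩ | ⟨_, ⟨p, hp, rfl⟩ | ⟨l, hl, rfl⟩, rfl⟩)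
      · exact hδA p hp
      · exact hδA p hp
      · simp only [δ, Sum.elim_inr, one_div]
        exact inv_anti₀ two_pos (by exact_mod_cast (Nat.prime_of_mem_primeFactors hl).two_le)
    · rwa [Finset.card_disjSum, Finset.card_disjSum, ← add_assoc, ← two_mul]
    · intro J hJ
      obtain ⟨s, t, b, rfl⟩ : ∃ s t b, J = Finset.disjSum s (Finset.disjSum t b) :=
        ⟨J.toLeft, J.toRight.toLeft, J.toRight.toRight, by simp [Finset.toLeft_disjSum_toRight]⟩
      have hs : s ⊆ A := fun p hp => by
        simpa using hJ (Finset.inl_mem_disjSum.2 hp)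
      have ht : t ⊆ A := fun p hp => by
        simpa using hJ (Finset.inr_mem_disjSum.2 (Finset.inl_mem_disjSum.2 hp))
      have hb : b ⊆ B := fun p hp => by
        simpa using hJ (Finset.inr_mem_disjSum.2 (Finset.inr_mem_disjSum.2 hp))
      have hbM : ∏ l ∈ b, l ∣ M := (Finset.prod_dvd_prod_of_subset _ _ _ hb).trans
        M.prod_primeFactors_dvd
      have key := abs_card_filter_sub_le (frobeniusKer F (h / ∏ p ∈ s, p)).toAddSubgroup
        (frobeniusKer F (h / ∏ p ∈ t, p)).toAddSubgroup
        (powMonoidHom (M / ∏ l ∈ b, l) : Fˣ →* Fˣ).ker.toAddSubgroup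
      rw [index_frobeniusKer_div_prod hg (hArel s hs) fun p hp => (hAmem p (hs hp)).2.2,
        index_frobeniusKer_div_prod hg (hArel t ht) fun p hp => (hAmem p (ht hp)).2.2,
        Subgroup.index_toAddSubgroup, index_ker_powMonoidHom_units (b := (∏ l ∈ b, l) * r)
          (by rw [← mul_assoc, Nat.div_mul_cancel hbM, hMr])] at key
      convert key using 3
      · rw [Finset.filter_filter]
        congr 2
        ext x
        have h1 : (∀ i ∈ s.disjSum (t.disjSum b), bad i x) ↔
            (∀ p ∈ s, (x : F) ∈ frobeniusKer F (h / p)) ∧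
            (∀ p ∈ t, (x : F)⁻¹ ∈ frobeniusKer F (h / p)) ∧ ∀ l ∈ b, x ^ (M / l) = 1 := by
          simp [Sum.forall, bad]
        have h2 : Additive.ofMul x ∈
            Subgroup.toAddSubgroup (powMonoidHom (M / ∏ l ∈ b, l) : Fˣ →* Fˣ).ker ↔
            x ^ (M / ∏ l ∈ b, l) = 1 := Iff.rfl
        rw [Finset.mem_filter, Finset.mem_filter, h1, h2, Submodule.mem_toAddSubgroup,
          Submodule.mem_toAddSubgroup,
          mem_frobeniusKer_div_prod_iff hm.ne_zero (hArel s hs) fun p hp => (hAmem p (hs hp)).2.2,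
          mem_frobeniusKer_div_prod_iff hm.ne_zero (hArel t ht) fun p hp => (hAmem p (ht hp)).2.2,
          pow_div_prod_eq_one_iff hM hb]
        tauto
      · simp only [Finset.prod_disjSum, δ, Sum.elim_inl, Sum.elim_inr, Finset.prod_inv_distrib]
        push_cast
        rw [div_mul_eq_mul_div, ← mul_inv, ← mul_inv, ← div_eq_mul_inv, div_div]
        congr 1
        ring
  obtain ⟨x, hxU, hx⟩ := hsieve
  simp only [Finset.mem_disjSum, U, Finset.mem_filter, Finset.mem_univ, true_and] at hx hxU
  refine ⟨x, ?_, ?_, ?_⟩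
  · refine orderOf_eq_of_pow_and_pow_div_prime (Nat.pos_of_ne_zero hM) hxU.2.2 fun l hl hlM => ?_
    exact hx (Sum.inr (Sum.inr l))
      (Or.inr ⟨_, Or.inr ⟨l, Nat.mem_primeFactors.2 ⟨hl, hlM, hM⟩, rfl⟩, rfl⟩)
  · refine isFqOrder_of_forall_notMem hm (Dvd.intro _ hg) hxU.1 fun p hpm hpi hph => ?_
    exact hx (Sum.inl p) (Or.inl ⟨p, (mem_primeFactors_iff hm.ne_zero).2 ⟨hpm, hpi, hph⟩, rfl⟩)
  · refine isFqOrder_of_forall_notMem hm (Dvd.intro _ hg) hxU.2.1 fun p hpm hpi hph => ?_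
    exact hx (Sum.inr (Sum.inl p)) (Or.inr ⟨_, Or.inl
      ⟨p, (mem_primeFactors_iff hm.ne_zero).2 ⟨hpm, hpi, hph⟩, rfl⟩, rfl⟩)

theorem pow_card_le_mul_prod_rpow {α : Type*} (s : Finset α) {w : α → ℝ} {b c : ℝ} {N : ℕ}
    (hw : ∀ i ∈ s, 1 ≤ w i) (hb : 1 ≤ b) (hc : 0 < c)
    (hN : (s.filter fun i => w i < b ^ (1 / c)).card ≤ N) :
    b ^ s.card ≤ b ^ N * (∏ i ∈ s, w i) ^ c := by
  have hb0 : 0 ≤ b := by linarith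
  have hw0 : ∀ i ∈ s, 0 ≤ w i := fun i hi => by linarith [hw i hi]
  rw [← Finset.card_filter_add_card_filter_not (fun i => w i < b ^ (1 / c)), pow_add]
  refine mul_le_mul (pow_le_pow_right₀ hb hN) ?_ (by positivity) (by positivity)
  rw [← Real.finsetProd_rpow _ _ hw0, ← Finset.prod_const]
  calc ∏ i ∈ s with ¬w i < b ^ (1 / c), b ≤ ∏ i ∈ s with ¬w i < b ^ (1 / c), w i ^ c :=
        Finset.prod_le_prod (fun _ _ => hb0) fun i hi => by
          have h := Real.rpow_le_rpow (by positivity) (not_lt.1 (Finset.mem_filter.1 hi).2) hc.le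
          rwa [← Real.rpow_mul hb0, one_div_mul_cancel hc.ne', Real.rpow_one] at h
    _ ≤ ∏ i ∈ s, w i ^ c := Finset.prod_le_prod_of_subset_of_one_le (Finset.filter_subset _ _)
        (fun i hi => Real.rpow_nonneg (hw0 i (Finset.mem_filter.1 hi).1) c)
        fun i hi _ => Real.one_le_rpow (hw i hi) hc.le

theorem Nat.pow_card_primeFactors_le {b c : ℝ} (hb : 1 ≤ b) (hc : 0 < c) {M : ℕ} (hM : M ≠ 0) :
    b ^ M.primeFactors.card ≤ b ^ ⌈b ^ (1 / c)⌉₊ * (M : ℝ) ^ c := by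
  have hb0 : 0 ≤ b := by linarith
  refine (pow_card_le_mul_prod_rpow M.primeFactors (w := fun l => (l : ℝ)) (fun l hl => ?_) hb hc
    (N := ⌈b ^ (1 / c)⌉₊) ?_).trans ?_
  · exact_mod_cast (Nat.prime_of_mem_primeFactors hl).one_le
  · refine (Finset.card_le_card fun l hl => ?_).trans (Finset.card_range _).le
    rw [Finset.mem_range]
    exact_mod_cast (Finset.mem_filter.1 hl).2.trans_le (Nat.le_ceil _)
  · refine mul_le_mul_of_nonneg_left (Real.rpow_le_rpow (by positivity) ?_ hc.le) (by positivity)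
    rw [← Nat.cast_prod]
    exact_mod_cast Nat.le_of_dvd (Nat.pos_of_ne_zero hM) M.prod_primeFactors_dvd

theorem Polynomial.card_filter_pow_natDegree_lt_le {K : Type*} [Field K] [Fintype K]
    (s : Finset K[X]) (hs : ∀ p ∈ s, 0 < p.natDegree) (T : ℝ) :
    (s.filter fun p => (Fintype.card K : ℝ) ^ p.natDegree < T).card ≤ ⌈T⌉₊ ^ 2 := by
  classical
  set q := Fintype.card K with hq
  have hq1 : 1 < q := Fintype.one_lt_card
  set N := ⌈T⌉₊
  have hlt : ∀ p ∈ s.filter fun p => (q : ℝ) ^ p.natDegree < T,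
      0 < p.natDegree ∧ q ^ p.natDegree < N := fun p hp => by
    rw [Finset.mem_filter] at hp
    refine ⟨hs p hp.1, ?_⟩
    exact_mod_cast hp.2.trans_le (Nat.le_ceil T)
  rcases (s.filter fun p => (q : ℝ) ^ p.natDegree < T).eq_empty_or_nonempty with he | ⟨p₀, hp₀⟩
  · rw [he, Finset.card_empty]
    exact Nat.zero_le _
  have hqN : q ≤ N := (Nat.le_self_pow (hlt p₀ hp₀).1.ne' q).trans (hlt p₀ hp₀).2.le
  have hN0 : N ≠ 0 := by omega
  calc (s.filter fun p => (q : ℝ) ^ p.natDegree < T).card ≤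
      (Finset.univ : Finset (Fin (Nat.log q N + 1) → K)).card := by
        refine Finset.card_le_card_of_injOn (fun p i => p.coeff i) (fun _ _ => Finset.mem_univ _)
          fun p hp p' hp' hpp => ?_
        have hdeg : ∀ p ∈ s.filter fun p => (q : ℝ) ^ p.natDegree < T,
            p.natDegree < Nat.log q N + 1 := fun p hp =>
          Nat.lt_succ_of_le (Nat.le_log_of_pow_le hq1 (hlt p hp).2.le)
        ext i
        by_cases hi : i < Nat.log q N + 1
        · exact congrFun hpp ⟨i, hi⟩
        · rw [coeff_eq_zero_of_natDegree_lt (lt_of_lt_of_le (hdeg p hp) (not_lt.1 hi)),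
            coeff_eq_zero_of_natDegree_lt (lt_of_lt_of_le (hdeg p' hp') (not_lt.1 hi))]
    _ = q ^ Nat.log q N * q := by
        rw [Finset.card_univ, Fintype.card_fun, Fintype.card_fin, ← hq, pow_succ]
    _ ≤ N ^ 2 := by
        rw [sq]
        exact Nat.mul_le_mul (Nat.pow_log_le_self q hN0) hqN

theorem Polynomial.pow_card_primeFactors_le {K : Type*} [Field K] [Fintype K] [DecidableEq K]
    {b c : ℝ} (hb : 1 ≤ b) (hc : 0 < c) {h : K[X]} (hh : h ≠ 0) :
    b ^ (UniqueFactorizationMonoid.primeFactors h).card ≤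
      b ^ (⌈b ^ (1 / c)⌉₊ ^ 2) * ((Fintype.card K : ℝ) ^ h.natDegree) ^ c := by
  have hb0 : 0 ≤ b := by linarith
  have hq : (1 : ℝ) ≤ Fintype.card K := by exact_mod_cast Fintype.card_pos
  have hmem : ∀ p ∈ UniqueFactorizationMonoid.primeFactors h, Irreducible p := fun p hp =>
    ((mem_primeFactors_iff hh).1 hp).2.1
  refine (pow_card_le_mul_prod_rpow (UniqueFactorizationMonoid.primeFactors h)
    (w := fun p => (Fintype.card K : ℝ) ^ p.natDegree) (fun p hp => one_le_pow₀ hq) hb hc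
    (card_filter_pow_natDegree_lt_le _ (fun p hp => (hmem p hp).natDegree_pos) _)).trans ?_
  refine mul_le_mul_of_nonneg_left (Real.rpow_le_rpow (by positivity) ?_ hc.le) (by positivity)
  rw [Finset.prod_pow_eq_pow_sum, ← natDegree_prod _ _ fun p hp => (hmem p hp).ne_zero]
  exact pow_le_pow_right₀ hq
    (natDegree_le_of_dvd UniqueFactorizationMonoid.radical_dvd_self hh)

open Classical in
theorem exists_forall_sieve_inequality (r k : ℕ) (hr : 1 ≤ r) :
    ∃ B : ℕ, ∀ (Fq F : Type) [Field Fq] [Field F] [Fintype Fq] [Fintype F] [Algebra Fq F],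
      B < Fintype.card F → 4 * k < Module.finrank Fq F → ∀ h g : Fq[X],
        h * g = X ^ Module.finrank Fq F - 1 → g.natDegree = k →
        ∀ M : ℕ, M * r = Fintype.card F - 1 →
          4 ^ (2 * (UniqueFactorizationMonoid.primeFactors h).card + M.primeFactors.card) *
            (2 * √(Fintype.card F)) <
              ((Fintype.card F : ℝ) - 1) / (r * (Fintype.card Fq : ℝ) ^ (2 * g.natDegree)) := by
  have hk : (0 : ℝ) < 4 * k + 1 := by positivity
  obtain ⟨c, hc⟩ : ∃ c : ℝ, c = 1 / (8 * (4 * k + 1)) := ⟨_, rfl⟩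
  have hc0 : 0 < c := by rw [hc]; positivity
  have hr0 : (0 : ℝ) < r := by exact_mod_cast hr
  set N₁ := ⌈(16 : ℝ) ^ (1 / c)⌉₊ ^ 2
  set N₂ := ⌈(4 : ℝ) ^ (1 / c)⌉₊
  obtain ⟨D, hD⟩ : ∃ D : ℝ, D = 16 ^ N₁ * 4 ^ N₂ * 4 * r := ⟨_, rfl⟩
  have hD0 : 0 < D := by rw [hD]; positivity
  refine ⟨⌈D ^ (1 / (2 * c))⌉₊, fun Fq F _ _ _ _ _ hB hn h g hg hgk M hMr => ?_⟩
  have h0 : (X ^ Module.finrank Fq F - 1 : Fq[X]) ≠ 0 := X_pow_sub_C_ne_zero Module.finrank_pos 1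
  have hh0 : h ≠ 0 := left_ne_zero_of_mul (hg ▸ h0)
  have hg0 : g ≠ 0 := right_ne_zero_of_mul (hg ▸ h0)
  have hdeg : h.natDegree ≤ Module.finrank Fq F := by
    have : (X ^ Module.finrank Fq F - 1 : Fq[X]).natDegree = Module.finrank Fq F := by
      rw [← C_1, natDegree_X_pow_sub_C]
    rw [← this, ← hg, natDegree_mul hh0 hg0]
    omega
  have hQ2 : (2 : ℝ) ≤ Fintype.card F := by exact_mod_cast Fintype.one_lt_card (α := F)
  have hq1 : (1 : ℝ) ≤ Fintype.card Fq := by exact_mod_cast Fintype.card_pos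
  have hQq : (Fintype.card F : ℝ) = (Fintype.card Fq : ℝ) ^ Module.finrank Fq F := by
    exact_mod_cast Module.card_eq_pow_finrank (K := Fq) (V := F)
  have hM0 : M ≠ 0 := by
    rintro rfl
    have := Fintype.one_lt_card (α := F)
    omega
  have hMQ : (M : ℝ) ≤ Fintype.card F := by
    have : M ≤ M * r := Nat.le_mul_of_pos_right M hr
    exact_mod_cast (by omega : M ≤ Fintype.card F)
  have hDQ : D < (Fintype.card F : ℝ) ^ (2 * c) := by
    have h1 : D ^ (1 / (2 * c)) < Fintype.card F :=
      (Nat.le_ceil _).trans_lt (by exact_mod_cast hB)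
    have h2 := Real.rpow_lt_rpow (by positivity) h1 (by positivity : 0 < 2 * c)
    rwa [← Real.rpow_mul hD0.le, one_div_mul_cancel (by positivity), Real.rpow_one] at h2
  have hpoly : (16 : ℝ) ^ (UniqueFactorizationMonoid.primeFactors h).card ≤
      16 ^ N₁ * (Fintype.card F : ℝ) ^ c := by
    refine (pow_card_primeFactors_le (by norm_num) hc0 hh0).trans
      (mul_le_mul_of_nonneg_left (Real.rpow_le_rpow (by positivity) ?_ hc0.le) (by positivity))
    rw [hQq]
    exact pow_le_pow_right₀ hq1 hdeg
  have hnat : (4 : ℝ) ^ M.primeFactors.card ≤ 4 ^ N₂ * (Fintype.card F : ℝ) ^ c :=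
    (Nat.pow_card_primeFactors_le (by norm_num) hc0 hM0).trans
      (mul_le_mul_of_nonneg_left (Real.rpow_le_rpow (by positivity) hMQ hc0.le) (by positivity))
  have hqk : (Fintype.card Fq : ℝ) ^ (2 * g.natDegree) ≤
      (Fintype.card F : ℝ) ^ (1 / 2 - 4 * c) := by
    rw [hQq, ← Real.rpow_natCast, ← Real.rpow_natCast, ← Real.rpow_mul (by positivity)]
    refine Real.rpow_le_rpow_of_exponent_le hq1 ?_
    have hn' : (4 * k + 1 : ℝ) ≤ Module.finrank Fq F := by exact_mod_cast hn
    have hexp : (1 / 2 - 4 * c : ℝ) = 2 * k / (4 * k + 1) := by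
      rw [hc]
      field_simp
      ring
    rw [hgk, hexp, mul_div_assoc', le_div_iff₀ hk]
    push_cast
    nlinarith [(Nat.cast_nonneg k : (0 : ℝ) ≤ k)]
  rw [lt_div_iff₀ (by positivity), pow_add, pow_mul, Real.sqrt_eq_rpow]
  norm_num only
  set Q := (Fintype.card F : ℝ)
  have hQ0 : 0 < Q := by linarith
  have hQpow : Q ^ c * Q ^ c * Q ^ (1 / 2 : ℝ) * Q ^ (1 / 2 - 4 * c) * Q ^ (2 * c) = Q := by
    rw [← Real.rpow_add hQ0, ← Real.rpow_add hQ0, ← Real.rpow_add hQ0, ← Real.rpow_add hQ0]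
    ring_nf
    exact Real.rpow_one Q
  calc (16 : ℝ) ^ (UniqueFactorizationMonoid.primeFactors h).card * 4 ^ M.primeFactors.card *
        (2 * Q ^ (1 / 2 : ℝ)) * (r * (Fintype.card Fq : ℝ) ^ (2 * g.natDegree)) ≤
        (16 ^ N₁ * Q ^ c) * (4 ^ N₂ * Q ^ c) * (2 * Q ^ (1 / 2 : ℝ)) *
          (r * Q ^ (1 / 2 - 4 * c)) := by gcongr
    _ = D * (Q ^ c * Q ^ c * Q ^ (1 / 2 : ℝ) * Q ^ (1 / 2 - 4 * c)) / 2 := by rw [hD]; ring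
    _ < Q ^ (2 * c) * (Q ^ c * Q ^ c * Q ^ (1 / 2 : ℝ) * Q ^ (1 / 2 - 4 * c)) / 2 := by gcongr
    _ = Q / 2 := by rw [mul_comm (Q ^ (2 * c)), hQpow]
    _ ≤ Q - 1 := by linarith

theorem exists_forall_isKNormal_pair (r k : ℕ) (hr : 1 ≤ r) :
    ∃ B : ℕ, ∀ (Fq F : Type) [Field Fq] [Field F] [Fintype Fq] [Fintype F] [Algebra Fq F],
      B < Fintype.card F → 4 * k < Module.finrank Fq F → r ∣ Fintype.card F - 1 →
      (∃ g : Fq[X], g.Monic ∧ g.natDegree = k ∧ g ∣ X ^ Module.finrank Fq F - 1) →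
      ∃ α : F, α ≠ 0 ∧ orderOf α = (Fintype.card F - 1) / r ∧
        orderOf α⁻¹ = (Fintype.card F - 1) / r ∧
        IsKNormal Fq (Fintype.card Fq) (Module.finrank Fq F) k α ∧
        IsKNormal Fq (Fintype.card Fq) (Module.finrank Fq F) k α⁻¹ := by
  obtain ⟨B, hB⟩ := exists_forall_sieve_inequality r k hr
  refine ⟨B, fun Fq F _ _ _ _ _ hBF hn hrF ⟨g, hgm, hgk, h, hg⟩ => ?_⟩
  have hg' : h * g = X ^ Module.finrank Fq F - 1 := by rw [hg, mul_comm]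
  have hX : (X ^ Module.finrank Fq F - 1 : Fq[X]).Monic :=
    monic_X_pow_sub_C 1 Module.finrank_pos.ne'
  have hm : h.Monic := hgm.of_mul_monic_left (hg ▸ hX)
  have hdeg : h.natDegree = Module.finrank Fq F - k := by
    have h1 : (X ^ Module.finrank Fq F - 1 : Fq[X]).natDegree = Module.finrank Fq F := by
      rw [← C_1, natDegree_X_pow_sub_C]
    rw [hg, hgm.natDegree_mul hm] at h1
    omega
  have hMr := Nat.div_mul_cancel hrF
  obtain ⟨x, hx, h1, h2⟩ := exists_orderOf_eq_and_isFqOrder hm hg' hMr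
    (hB Fq F hBF hn h g hg' hgk _ hMr)
  refine ⟨x, x.ne_zero, by rw [orderOf_units, hx], ?_, ⟨h, h1, hdeg⟩, ⟨h, h2, hdeg⟩⟩
  rw [← Units.val_inv_eq_inv_val, orderOf_units, orderOf_inv, hx]

/-- For fixed `r ≥ 1` and `k ≥ 0`, the set of pairs `(q, n)` — with `q` a prime power
and `n > 2ϑ` such that `r ∣ q^n - 1` and `x^n - 1` has a monic degree-`k` divisor
over `F_q` — for which no pair `(α, α⁻¹)` of `r`-primitive `k`-normal elements exists
in `F_{q^n}` over `F_q`, is finite. Here `ϑ = 2k` if `gcd(q,n) = 1`, else `ϑ = 3k`. -/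
theorem finite_exceptions_r_primitive_k_normal_pair (r k : ℕ) (hr : 1 ≤ r) :
    {qn : ℕ × ℕ | IsPrimePow qn.1 ∧
      2 * (if Nat.gcd qn.1 qn.2 = 1 then 2 * k else 3 * k) < qn.2 ∧
      r ∣ qn.1 ^ qn.2 - 1 ∧
      ∀ (Fq F : Type) [Field Fq] [Field F] [Fintype Fq] [Fintype F] [Algebra Fq F],
        Fintype.card Fq = qn.1 → Module.finrank Fq F = qn.2 →
        (∃ g : Fq[X], g.Monic ∧ g.natDegree = k ∧ g ∣ (X ^ qn.2 - 1 : Fq[X])) ∧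
        ¬ ∃ α : F, α ≠ 0 ∧ orderOf α = (qn.1 ^ qn.2 - 1) / r ∧
          orderOf α⁻¹ = (qn.1 ^ qn.2 - 1) / r ∧
          IsKNormal Fq qn.1 qn.2 k α ∧ IsKNormal Fq qn.1 qn.2 k α⁻¹}.Finite := by
  obtain ⟨B, hB⟩ := exists_forall_isKNormal_pair r k hr
  refine ((Finset.range (B + 1) ×ˢ Finset.range (B + 1)).finite_toSet).subset ?_
  rintro ⟨q, n⟩ ⟨hq, hn, hrq, hF⟩
  simp only at hn hrq hF
  have hn' : 4 * k < n := by split_ifs at hn <;> omega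
  have hq1 : 1 < q := hq.one_lt
  obtain ⟨p, m, hp, hm, rfl⟩ := hq
  have : Fact p.Prime := ⟨hp.nat_prime⟩
  have : NeZero n := ⟨by omega⟩
  let _ : Fintype (GaloisField p m) := Fintype.ofFinite _
  let _ : Fintype (FiniteField.Extension (GaloisField p m) p n) := Fintype.ofFinite _
  have hcard : Fintype.card (GaloisField p m) = p ^ m := by
    rw [← Nat.card_eq_fintype_card, GaloisField.card p m hm.ne']
  have hrank := FiniteField.finrank_extension (GaloisField p m) p n
  have hcardF : Fintype.card (FiniteField.Extension (GaloisField p m) p n) = (p ^ m) ^ n := by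
    rw [Module.card_eq_pow_finrank (K := GaloisField p m), hcard, hrank]
  obtain ⟨hg, hno⟩ := hF (GaloisField p m) (FiniteField.Extension (GaloisField p m) p n) hcard hrank
  have hle : (p ^ m) ^ n ≤ B := by
    by_contra! hlt
    have := hB (GaloisField p m) (FiniteField.Extension (GaloisField p m) p n)
    rw [hrank, hcardF, hcard] at this
    exact hno (this hlt hn' hrq hg)
  have h1 : p ^ m ≤ (p ^ m) ^ n := Nat.le_self_pow (by omega) _
  have h2 : n < (p ^ m) ^ n := Nat.lt_pow_self hq1
  simp only [Finset.coe_product, Finset.coe_range, Set.mem_prod, Set.mem_Iio]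
  omega

end
end

section
/- (Sieving inequality) Let r divide q^n - 1, let k be a non-negative integer and g in P_k. Let d be a divisor of R and {p_1, ..., p_l} the set of remaining distinct primes dividing R (i.e., those not dividing d). Let h be a monic divisor of x^n - 1 and {h_1, ..., h_m} the set of remaining distinct monic irreducible factors of x^n - 1, and let H be a monic divisor of G and {H_1, ..., H_{m'}} the set of remaining distinct monic irreducible factors of G. Then N_{r,k,g}(x^n - 1, R, G) >= Σ_{i=1}^{m} N_{r,k,g}(h·h_i, d, H) + Σ_{i=1}^{l} N_{r,k,g}(h, d·p_i, H) + Σ_{i=1}^{m'} N_{r,k,g}(h, d, H·H_i) - (m + l + m' - 1)·N_{r,k,g}(h, d, H). -/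
open Polynomial UniqueFactorizationMonoid
open scoped Classical

noncomputable section

/-- `β` is `h`-free: `gcd(h, (x^n - 1)/Ord_q(β)) = 1`. -/
def IsPolyFree {Fq F : Type*} [Field Fq] [Field F] [Algebra Fq F]
    (q n : ℕ) (h : Fq[X]) (β : F) : Prop :=
  ∃ f : Fq[X], IsFqOrder q n f β ∧ IsCoprime h ((X ^ n - 1 : Fq[X]) / f)

/-- `rad(m)`: product of the distinct primes dividing `m`. -/
def radN (m : ℕ) : ℕ := ∏ p ∈ m.primeFactors, p

/-- `W(m)`: number of squarefree divisors of `m`. -/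
def Wnat (m : ℕ) : ℕ := (m.divisors.filter Squarefree).card

/-- `rad(f)`: product of the distinct monic irreducible factors of `f`. -/
def radPoly {Fq : Type*} [Field Fq] (f : Fq[X]) : Fq[X] :=
  (normalizedFactors f).toFinset.prod id

/-- `W(f)`: number of monic squarefree divisors of `f`. -/
def Wpoly {Fq : Type*} [Field Fq] (f : Fq[X]) : ℕ :=
  {g : Fq[X] | g.Monic ∧ Squarefree g ∧ g ∣ f}.ncard

/-- The primes `p_1, …, p_s` in the decomposition `r = u·p_1^{b_1}···p_s^{b_s}`:
primes `p ∣ r` such that `p^{b_p + 1} ∣ M` where `b_p` is the multiplicity of `p`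
in `r` (here `M = q^n - 1`). -/
def rBadPrimes (r M : ℕ) : Finset ℕ :=
  r.primeFactors.filter fun p => p ^ (r.factorization p + 1) ∣ M

/-- `Q_r^d`: the set of `α ∈ F_{q^n}^*` that are `d`-free, are `r`-th powers, but are
not `λ_j = p_j^{b_j+1}`-th powers for any of the primes `p_j` in the decomposition
of `r`. -/
def QSet (F : Type*) [Field F] (q n r d : ℕ) : Set F :=
  {α | α ≠ 0 ∧ Nat.gcd d ((q ^ n - 1) / orderOf α) = 1 ∧
    (∃ β : F, β ^ r = α) ∧
    ∀ p ∈ rBadPrimes r (q ^ n - 1), ∀ β : F, β ^ p ^ (r.factorization p + 1) ≠ α}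

/-- The irreducible factors `f_1, …, f_t` in the decomposition
`g = π·f_1^{b_1}···f_t^{b_t}`: monic irreducible `f ∣ g` with `f^{b_f + 1} ∣ M`
where `b_f` is the multiplicity of `f` in `g` (here `M = x^n - 1`). -/
def gBadFactors {Fq : Type*} [Field Fq] (g M : Fq[X]) : Finset (Fq[X]) :=
  (normalizedFactors g).toFinset.filter
    fun f => f ^ ((normalizedFactors g).count f + 1) ∣ M

/-- `T_{g,k}^H`: the set of `α ∈ F_{q^n}` that are `H`-free, of the form `g∘β`, but
not of the form `Λ_i∘β` for `Λ_i = f_i^{b_i+1}`. -/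
def TSet {Fq : Type*} (F : Type*) [Field Fq] [Field F] [Algebra Fq F]
    (q n : ℕ) (g H : Fq[X]) : Set F :=
  {α | IsPolyFree q n H α ∧ (∃ β : F, polyAct q g β = α) ∧
    ∀ f ∈ gBadFactors g (X ^ n - 1 : Fq[X]), ∀ β : F,
      polyAct q (f ^ ((normalizedFactors g).count f + 1)) β ≠ α}

/-- `N_{r,k,g}(h, d, H)`: the number of `β ∈ F_{q^n}` such that `β` is `h`-free,
`g∘β ∈ Q_r^d` and `(g∘β)⁻¹ ∈ T_{g,k}^H`. -/
def Ncnt {Fq : Type*} (F : Type*) [Field Fq] [Field F] [Algebra Fq F]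
    (q n r : ℕ) (g h : Fq[X]) (d : ℕ) (H : Fq[X]) : ℕ :=
  {β : F | IsPolyFree q n h β ∧ polyAct q g β ∈ QSet F q n r d ∧
    (polyAct q g β)⁻¹ ∈ TSet F q n g H}.ncard

theorem polyAct_eq_aeval {Fq F : Type*} [Field Fq] [Field F] [Fintype Fq] [Algebra Fq F]
    (f : Fq[X]) (β : F) :
    polyAct (Fintype.card Fq) f β =
      aeval (FiniteField.frobeniusAlgHom Fq F).toLinearMap f β := by
  have hpow : ∀ i : ℕ, ((FiniteField.frobeniusAlgHom Fq F).toLinearMap ^ i) β =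
      β ^ Fintype.card Fq ^ i := by
    intro i
    rw [Module.End.pow_apply, AlgHom.coe_toLinearMap, FiniteField.coe_frobeniusAlgHom, pow_iterate]
  simp [polyAct, aeval_eq_sum_range, sum_over_range, Algebra.smul_def, hpow]

theorem IsFqOrder.unique {Fq F : Type*} [Field Fq] [Field F] [Fintype Fq] [Algebra Fq F]
    {n : ℕ} {f₁ f₂ : Fq[X]} {β : F}
    (h₁ : IsFqOrder (Fintype.card Fq) n f₁ β) (h₂ : IsFqOrder (Fintype.card Fq) n f₂ β) :
    f₁ = f₂ := by
  suffices key : ∀ {a b : Fq[X]}, IsFqOrder (Fintype.card Fq) n a β →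
      IsFqOrder (Fintype.card Fq) n b β → a ∣ b from
    eq_of_monic_of_associated h₁.1 h₂.1 (associated_of_dvd_dvd (key h₁ h₂) (key h₂ h₁))
  intro a b ha hb
  obtain ⟨ham, hadvd, haβ, hmin⟩ := ha
  obtain ⟨-, -, hbβ, -⟩ := hb
  have hga : EuclideanDomain.gcd a b ∣ a := EuclideanDomain.gcd_dvd_left a b
  have hg0 : EuclideanDomain.gcd a b ≠ 0 := ne_zero_of_dvd_ne_zero ham.ne_zero hga
  have hassoc : Associated (normalize (EuclideanDomain.gcd a b)) (EuclideanDomain.gcd a b) :=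
    normalize_associated _
  have hnorm : polyAct (Fintype.card Fq) (normalize (EuclideanDomain.gcd a b)) β = 0 := by
    obtain ⟨c, hc⟩ := hassoc.symm.dvd
    rw [polyAct_eq_aeval] at haβ hbβ ⊢
    rw [hc, EuclideanDomain.gcd_eq_gcd_ab, mul_comm _ c, mul_comm a, mul_comm b]
    simp [haβ, hbβ]
  have hdeg := hmin _ (monic_normalize hg0) ((hassoc.dvd.trans hga).trans hadvd) hnorm
  have heq := eq_of_monic_of_dvd_of_natDegree_le (monic_normalize hg0) ham
    (hassoc.dvd.trans hga) hdeg
  rw [heq]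
  exact hassoc.dvd.trans (EuclideanDomain.gcd_dvd_right a b)

theorem IsPolyFree.of_mul_left {Fq F : Type*} [Field Fq] [Field F] [Algebra Fq F]
    {q n : ℕ} {h f : Fq[X]} {β : F} (hβ : IsPolyFree q n (h * f) β) : IsPolyFree q n h β := by
  obtain ⟨e, he, hcop⟩ := hβ
  exact ⟨e, he, hcop.of_mul_left_left⟩

/-- Freeness with respect to `M` follows from freeness with respect to `h` and to every `h * f`
with `f` an irreducible factor of `M` not dividing `h`. -/
theorem IsPolyFree.of_forall_mul {Fq F : Type*} [Field Fq] [Field F] [Fintype Fq] [Algebra Fq F]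
    {n : ℕ} {M h : Fq[X]} (hM : M ≠ 0) {β : F} (hβ : IsPolyFree (Fintype.card Fq) n h β)
    (hmul : ∀ f ∈ (normalizedFactors M).toFinset.filter (fun f => ¬ f ∣ h),
      IsPolyFree (Fintype.card Fq) n (h * f) β) :
    IsPolyFree (Fintype.card Fq) n M β := by
  obtain ⟨e, he, hcop⟩ := hβ
  refine ⟨e, he, isCoprime_of_irreducible_dvd (fun h0 => hM h0.1) fun f hf hfM hfe => ?_⟩
  obtain ⟨p, hp, hpf⟩ := exists_mem_normalizedFactors_of_dvd hM hf hfM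
  have hirr := irreducible_of_normalized_factor p hp
  have hpe := hpf.symm.dvd.trans hfe
  by_cases hph : p ∣ h
  · exact hirr.not_isUnit (hcop.isUnit_of_dvd' hph hpe)
  · obtain ⟨e', he', hcop'⟩ := hmul p
      (Finset.mem_filter.mpr ⟨Multiset.mem_toFinset.mpr hp, hph⟩)
    rw [← he.unique he'] at hcop'
    exact hirr.not_isUnit (hcop'.isUnit_of_dvd' (dvd_mul_left p h) hpe)

theorem coprime_of_forall_mul {R d m : ℕ} (hR : R ≠ 0) (hdm : Nat.gcd d m = 1)
    (hmul : ∀ p ∈ R.primeFactors.filter (fun p => ¬ p ∣ d), Nat.gcd (d * p) m = 1) :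
    Nat.gcd R m = 1 := by
  refine Nat.coprime_of_dvd fun p hp hpR hpm => ?_
  by_cases hpd : p ∣ d
  · exact hp.one_lt.ne' (Nat.dvd_one.mp (hdm ▸ Nat.dvd_gcd hpd hpm))
  · have := hmul p (by simp [hp, hpR, hR, hpd])
    exact hp.one_lt.ne' (Nat.dvd_one.mp (this ▸ Nat.dvd_gcd (dvd_mul_left p d) hpm))

theorem radN_div_radN_ne_zero {r m : ℕ} (hm : m ≠ 0) (hrm : r ∣ m) :
    radN m / radN r ≠ 0 := by
  have hdvd : radN r ∣ radN m :=
    Finset.prod_dvd_prod_of_subset _ _ _ (Nat.primeFactors_mono hrm hm)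
  have hpos : radN m ≠ 0 :=
    Finset.prod_ne_zero_iff.mpr fun p hp => (Nat.prime_of_mem_primeFactors hp).ne_zero
  intro h0
  exact hpos (Nat.eq_zero_of_dvd_of_div_eq_zero hdvd h0)

theorem radPoly_div_radPoly_ne_zero {Fq : Type*} [Field Fq] {g M : Fq[X]} (hM : M ≠ 0)
    (hgM : g ∣ M) : radPoly M / radPoly g ≠ 0 := by
  have hdvd : radPoly g ∣ radPoly M :=
    Finset.prod_dvd_prod_of_subset _ _ _ (Multiset.toFinset_subset.mpr
      (Multiset.subset_of_le ((dvd_iff_normalizedFactors_le_normalizedFactors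
        (ne_zero_of_dvd_ne_zero hM hgM) hM).mp hgM)))
  have hne : radPoly M ≠ 0 :=
    Finset.prod_ne_zero_iff.mpr fun f hf =>
      (irreducible_of_normalized_factor f (Multiset.mem_toFinset.mp hf)).ne_zero
  intro h0
  have := EuclideanDomain.mul_div_cancel' (ne_zero_of_dvd_ne_zero hne hdvd) hdvd
  rw [h0, mul_zero] at this
  exact hne this.symm

theorem ncard_biUnion_sdiff_le {α ι : Type*} [Finite α] {S : Set α} (I : Finset ι)
    {A : ι → Set α} (hA : ∀ i ∈ I, A i ⊆ S) :
    ((⋃ i ∈ I, S \ A i).ncard : ℤ) ≤ (I.card : ℤ) * S.ncard - ∑ i ∈ I, ((A i).ncard : ℤ) := by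
  calc ((⋃ i ∈ I, S \ A i).ncard : ℤ) ≤ ∑ i ∈ I, ((S \ A i).ncard : ℤ) := by
        exact_mod_cast I.set_ncard_biUnion_le _
    _ = ∑ i ∈ I, ((S.ncard : ℤ) - (A i).ncard) := by
        refine Finset.sum_congr rfl fun i hi => ?_
        have := Set.ncard_sdiff_add_ncard_of_subset (hA i hi)
        lia
    _ = _ := by simp [Finset.sum_sub_distrib]

/-- Inclusion-exclusion lower bound for three families of subsets of `S`. -/
theorem sieve_ncard_le {α ι κ μ : Type*} [Finite α] {S T : Set α}
    (I : Finset ι) (J : Finset κ) (K : Finset μ) {A : ι → Set α} {B : κ → Set α} {C : μ → Set α}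
    (hA : ∀ i ∈ I, A i ⊆ S) (hB : ∀ j ∈ J, B j ⊆ S) (hC : ∀ k ∈ K, C k ⊆ S)
    (hT : ∀ x ∈ S, (∀ i ∈ I, x ∈ A i) → (∀ j ∈ J, x ∈ B j) → (∀ k ∈ K, x ∈ C k) → x ∈ T) :
    (∑ i ∈ I, ((A i).ncard : ℤ)) + (∑ j ∈ J, ((B j).ncard : ℤ)) + (∑ k ∈ K, ((C k).ncard : ℤ)) -
      ((I.card : ℤ) + (J.card : ℤ) + (K.card : ℤ) - 1) * (S.ncard : ℤ) ≤ (T.ncard : ℤ) := by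
  have hsub : S ⊆ T ∪ ((⋃ i ∈ I, S \ A i) ∪ ((⋃ j ∈ J, S \ B j) ∪ (⋃ k ∈ K, S \ C k))) := by
    intro x hx
    by_contra hcon
    simp only [Set.mem_union, Set.mem_iUnion, Set.mem_sdiff, exists_prop, not_or, not_exists,
      not_and, not_not] at hcon
    exact hcon.1 (hT x hx (fun i hi => hcon.2.1 i hi hx) (fun j hj => hcon.2.2.1 j hj hx)
      (fun k hk => hcon.2.2.2 k hk hx))
  have h₀ := Set.ncard_le_ncard hsub
  have h₁ := Set.ncard_union_le T
    ((⋃ i ∈ I, S \ A i) ∪ ((⋃ j ∈ J, S \ B j) ∪ (⋃ k ∈ K, S \ C k)))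
  have h₂ := Set.ncard_union_le (⋃ i ∈ I, S \ A i) ((⋃ j ∈ J, S \ B j) ∪ (⋃ k ∈ K, S \ C k))
  have h₃ := Set.ncard_union_le (⋃ j ∈ J, S \ B j) (⋃ k ∈ K, S \ C k)
  have hI := ncard_biUnion_sdiff_le I hA
  have hJ := ncard_biUnion_sdiff_le J hB
  have hK := ncard_biUnion_sdiff_le K hC
  zify at h₀ h₁ h₂ h₃
  linarith

/-- Sieving inequality: `N_{r,k,g}(x^n-1, R, G) ≥ Σ_i N(h·h_i, d, H) +
Σ_i N(h, d·p_i, H) + Σ_i N(h, d, H·H_i) − (m + l + m' − 1)·N(h, d, H)`, where the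
`h_i`, `p_i`, `H_i` are the remaining irreducible/prime factors of `x^n - 1`, `R`,
`G` respectively. -/
theorem sieving_inequality
    (q n r k : ℕ) (hq : IsPrimePow q) (hn : 0 < n) (hr : 0 < r)
    (hrdvd : r ∣ q ^ n - 1)
    (Fq F : Type*) [Field Fq] [Field F] [Fintype Fq] [Fintype F] [Algebra Fq F]
    (hcard : Fintype.card Fq = q) (hdim : Module.finrank Fq F = n)
    (g : Fq[X]) (hgm : g.Monic) (hgd : g.natDegree = k)
    (hgdvd : g ∣ (X ^ n - 1 : Fq[X]))
    (h : Fq[X]) (hhm : h.Monic) (hhdvd : h ∣ (X ^ n - 1 : Fq[X]))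
    (d : ℕ) (hd : d ∣ radN (q ^ n - 1) / radN r)
    (H : Fq[X]) (hHm : H.Monic)
    (hHdvd : H ∣ radPoly (X ^ n - 1 : Fq[X]) / radPoly g) :
    (Ncnt F q n r g (X ^ n - 1 : Fq[X]) (radN (q ^ n - 1) / radN r)
        (radPoly (X ^ n - 1 : Fq[X]) / radPoly g) : ℤ) ≥
      (∑ f ∈ (normalizedFactors (X ^ n - 1 : Fq[X])).toFinset.filter
          (fun f => ¬ f ∣ h), (Ncnt F q n r g (h * f) d H : ℤ)) +
      (∑ p ∈ (radN (q ^ n - 1) / radN r).primeFactors.filter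
          (fun p => ¬ p ∣ d), (Ncnt F q n r g h (d * p) H : ℤ)) +
      (∑ f ∈ (normalizedFactors
            (radPoly (X ^ n - 1 : Fq[X]) / radPoly g)).toFinset.filter
          (fun f => ¬ f ∣ H), (Ncnt F q n r g h d (H * f) : ℤ)) -
      ((((normalizedFactors (X ^ n - 1 : Fq[X])).toFinset.filter
            (fun f => ¬ f ∣ h)).card : ℤ) +
        (((radN (q ^ n - 1) / radN r).primeFactors.filter
            (fun p => ¬ p ∣ d)).card : ℤ) +
        (((normalizedFactors
              (radPoly (X ^ n - 1 : Fq[X]) / radPoly g)).toFinset.filter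
            (fun f => ¬ f ∣ H)).card : ℤ) - 1) *
        (Ncnt F q n r g h d H : ℤ) := by
  subst hcard
  have hM : (X ^ n - 1 : Fq[X]) ≠ 0 := (monic_X_pow_sub_C (1 : Fq) hn.ne').ne_zero
  have hqn : Fintype.card Fq ^ n - 1 ≠ 0 :=
    (Nat.sub_pos_of_lt (Nat.one_lt_pow hn.ne' hq.one_lt)).ne'
  refine sieve_ncard_le _ _ _ (fun f _ β hβ => ⟨hβ.1.of_mul_left, hβ.2⟩) ?_ ?_ ?_
  · rintro p - β ⟨hh, ⟨h0, hd', hQ⟩, hT⟩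
    exact ⟨hh, ⟨h0, Nat.Coprime.coprime_mul_right hd', hQ⟩, hT⟩
  · rintro f - β ⟨hh, hQ, hf, hT⟩
    exact ⟨hh, hQ, hf.of_mul_left, hT⟩
  · rintro β ⟨hh, ⟨h0, hd', hQ⟩, hf, hT⟩ hA hB hC
    exact ⟨hh.of_forall_mul hM fun f hf => (hA f hf).1,
      ⟨h0, coprime_of_forall_mul (radN_div_radN_ne_zero hqn hrdvd) hd'
        fun p hp => (hB p hp).2.1.2.1, hQ⟩,
      hf.of_forall_mul (radPoly_div_radPoly_ne_zero hM hgdvd) fun f hf => (hC f hf).2.2.1, hT⟩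

end
end
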